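/- arXiv:2510.14424 — 2 statements merged into one kernel-verified Lean document; each statement's English description precedes it below -/
import Mathlib

section
/- Let q = p^h with p prime and h ≥ 1. There exist real constants A > 0 and ε > 0 such that for every function k : ℕ → ℕ satisfying k(n) ≤ n for all n and lim_{n→∞} ( n²/4 − ε·n + A·√n − k(n)·(n − k(n)) ) = −∞ (condition (⋆)), the ratio N^Γ_{k(n),n} / N^Γ_n between the number of semilinear equivalence classes of k(n)-dimensional linear codes in F_q^n and the total number of semilinear equivalence classes of linear codes in F_q^n satisfies N^Γ_{k(n),n} / N^Γ_n ∼ p(k(n), n) := binom(n, k(n))_q / S(n) as n → ∞. -/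
open Filter Matrix
open scoped Topology

/-- The `q`-binomial coefficient `binom(n,k)_q = ∏_{j=0}^{k-1} (q^{n-j}-1)/(q^{k-j}-1)`. -/
noncomputable def qBinom (q n k : ℕ) : ℝ :=
  ∏ j ∈ Finset.range k, ((q : ℝ) ^ (n - j) - 1) / ((q : ℝ) ^ (k - j) - 1)

/-- `S(n) = ∑_{k=0}^n binom(n,k)_q`. -/
noncomputable def Sq (q n : ℕ) : ℝ := ∑ k ∈ Finset.range (n + 1), qBinom q n k

/-- `K_q = ∏_{j=1}^∞ (1 - q^{-j})`. -/
noncomputable def Kq (q : ℕ) : ℝ := ∏' j : ℕ, (1 - ((q : ℝ))⁻¹ ^ (j + 1))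

/-- `K_q(k) = ∏_{j=1}^{k} (1 - q^{-j})`. -/
noncomputable def KqTrunc (q k : ℕ) : ℝ := ∏ j ∈ Finset.range k, (1 - ((q : ℝ))⁻¹ ^ (j + 1))

/-- Jacobi theta constant `θ₂(w) = ∑_{k∈ℤ} w^{(k+1/2)²}`. -/
noncomputable def theta2 (w : ℝ) : ℝ := ∑' k : ℤ, w ^ (((k : ℝ) + 1/2) ^ 2)

/-- Jacobi theta constant `θ₃(w) = ∑_{k∈ℤ} w^{k²}`. -/
noncomputable def theta3 (w : ℝ) : ℝ := ∑' k : ℤ, w ^ ((k : ℝ) ^ 2)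

/-- Condition (⋆): `n²/4 − ε·n + A·√n − k(n)(n−k(n)) → −∞`. -/
def StarCond (A ε : ℝ) (k : ℕ → ℕ) : Prop :=
  Tendsto (fun n : ℕ =>
    (n : ℝ) ^ 2 / 4 - ε * n + A * Real.sqrt n - (k n : ℝ) * ((n : ℝ) - (k n : ℝ)))
    atTop atBot

/-- The set of permutation matrices inside `GL n F`. -/
def permSet (F : Type) [Field F] (n : ℕ) : Set (GL (Fin n) F) :=
  {M | ∃ σ : Equiv.Perm (Fin n), (M : Matrix (Fin n) (Fin n) F) = σ.permMatrix F}

/-- The set of invertible diagonal matrices inside `GL n F`. -/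
def diagSet (F : Type) [Field F] (n : ℕ) : Set (GL (Fin n) F) :=
  {M | ∃ d : Fin n → F, (M : Matrix (Fin n) (Fin n) F) = Matrix.diagonal d}

/-- The permutation group: subgroup of `GL n F` formed by the permutation matrices. -/
def PermGroup (F : Type) [Field F] (n : ℕ) : Subgroup (GL (Fin n) F) :=
  Subgroup.closure (permSet F n)

/-- The monomial group: subgroup of `GL n F` generated by permutation and diagonal matrices. -/
def MonomialGroup (F : Type) [Field F] (n : ℕ) : Subgroup (GL (Fin n) F) :=
  Subgroup.closure (permSet F n ∪ diagSet F n)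

/-- Number of orbits of a subgroup `G ≤ GL n F` acting on the Grassmannian of
`k`-dimensional subspaces of `F^n` (by taking images of subspaces). -/
noncomputable def numClassesDim {n : ℕ} (F : Type) [Field F]
    (G : Subgroup (GL (Fin n) F)) (k : ℕ) : ℕ :=
  Nat.card (Quot (fun V W : {V : Submodule F (Fin n → F) // Module.finrank F V = k} =>
    ∃ M ∈ G, Submodule.map (Matrix.toLin' (M : Matrix (Fin n) (Fin n) F)) V.1 = W.1))

/-- Number of orbits of a subgroup `G ≤ GL n F` acting on the set of all subspaces of `F^n`. -/
noncomputable def numClasses {n : ℕ} (F : Type) [Field F]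
    (G : Subgroup (GL (Fin n) F)) : ℕ :=
  Nat.card (Quot (fun V W : Submodule F (Fin n → F) =>
    ∃ M ∈ G, Submodule.map (Matrix.toLin' (M : Matrix (Fin n) (Fin n) F)) V = W))

/-- Semilinear orbit relation: `W` is the image of `V` under the semilinear transformation
given by applying the field automorphism `σ` componentwise followed by a monomial matrix. -/
def semiRel (F : Type) [Field F] (n : ℕ) (V W : Submodule F (Fin n → F)) : Prop :=
  ∃ σ : F ≃+* F, ∃ M ∈ MonomialGroup F n,
    (W : Set (Fin n → F)) =
      (fun x => Matrix.mulVec (M : Matrix (Fin n) (Fin n) F) (fun i => σ (x i))) '' (V : Set (Fin n → F))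

/-- Number of semilinear equivalence classes of `k`-dimensional subspaces of `F^n`. -/
noncomputable def numClassesDimSemi (F : Type) [Field F] (n k : ℕ) : ℕ :=
  Nat.card (Quot (fun V W : {V : Submodule F (Fin n → F) // Module.finrank F V = k} =>
    semiRel F n V.1 W.1))

/-- Number of semilinear equivalence classes of subspaces of `F^n`. -/
noncomputable def numClassesSemi (F : Type) [Field F] (n : ℕ) : ℕ :=
  Nat.card (Quot (fun V W : Submodule F (Fin n → F) => semiRel F n V W))

open Classical in
/-- Partial products of `∏ (1 - 2^{-t})` stay above `1/4`. -/
theorem quarter_le_prod_one_sub_half_pow (d : ℕ) :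
    (1 / 4 : ℝ) ≤ ∏ i ∈ Finset.range d, (1 - (1 / 2 : ℝ) ^ (i + 1)) := by
  have key : ∀ s : ℕ, (1 / 4 : ℝ) + (1 / 2) ^ (s + 2) ≤
      ∏ i ∈ Finset.range (s + 1), (1 - (1 / 2 : ℝ) ^ (i + 1)) := by
    intro s
    induction s with
    | zero => norm_num
    | succ s ih =>
      rw [Finset.prod_range_succ]
      have hy : (1 / 2 : ℝ) ^ (s + 2) ≤ 1 / 4 := by
        rw [pow_add]
        have : (1 / 2 : ℝ) ^ s ≤ 1 := pow_le_one₀ (by norm_num) (by norm_num)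
        nlinarith
      have hy0 : 0 < (1 / 2 : ℝ) ^ (s + 2) := by positivity
      have e1 : (1 / 2 : ℝ) ^ (s + 1 + 2) = (1 / 2) ^ (s + 2) / 2 := by ring
      have e2 : (1 / 2 : ℝ) ^ (s + 1 + 1) = (1 / 2) ^ (s + 2) := by ring
      rw [e1, e2]
      generalize (1 / 2 : ℝ) ^ (s + 2) = y at *
      have : (1 / 4 + y) * (1 - y) ≤
          (∏ i ∈ Finset.range (s + 1), (1 - (1 / 2 : ℝ) ^ (i + 1))) * (1 - y) :=
        mul_le_mul_of_nonneg_right ih (by linarith)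
      nlinarith
  cases d with
  | zero => norm_num
  | succ s =>
    have := key s
    have h : (0 : ℝ) < (1 / 2) ^ (s + 2) := by positivity
    linarith

theorem pow_le_four_mul_prod_sub {q x j d : ℕ} (hq : 2 ≤ q) (hx : q ^ (j + d) ≤ x) :
    x ^ d ≤ 4 * ∏ i ∈ Finset.range d, (x - q ^ (j + i)) := by
  have hx0 : (0 : ℝ) < x := by
    have : 0 < x := lt_of_lt_of_le (by positivity) hx
    exact_mod_cast this
  have hle : ∀ i ∈ Finset.range d, q ^ (j + i) ≤ x := fun i hi =>
    le_trans (Nat.pow_le_pow_right (by omega) (by have := Finset.mem_range.1 hi; omega)) hx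
  have hreal : (x : ℝ) ^ d ≤ 4 * ∏ i ∈ Finset.range d, ((x : ℝ) - (q : ℝ) ^ (j + i)) := by
    have h1 : ∏ i ∈ Finset.range d, ((x : ℝ) * (1 - (1 / 2) ^ (d - 1 - i + 1))) ≤
        ∏ i ∈ Finset.range d, ((x : ℝ) - (q : ℝ) ^ (j + i)) := by
      refine Finset.prod_le_prod ?_ ?_
      · intro i _
        have : (1 / 2 : ℝ) ^ (d - 1 - i + 1) ≤ 1 := pow_le_one₀ (by norm_num) (by norm_num)
        exact mul_nonneg hx0.le (by linarith)
      · intro i hi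
        have hi' := Finset.mem_range.1 hi
        have e : d - 1 - i + 1 = d - i := by omega
        rw [e]
        have h2 : (q : ℝ) ^ (j + i) * 2 ^ (d - i) ≤ x := by
          have : q ^ (j + i) * 2 ^ (d - i) ≤ x := by
            calc q ^ (j + i) * 2 ^ (d - i) ≤ q ^ (j + i) * q ^ (d - i) := by gcongr
              _ = q ^ (j + d) := by rw [← pow_add]; congr 1; omega
              _ ≤ x := hx
          exact_mod_cast this
        have h3 : (q : ℝ) ^ (j + i) ≤ x * (1 / 2) ^ (d - i) := by
          rw [one_div, inv_pow, ← div_eq_mul_inv, le_div_iff₀ (by positivity)]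
          exact h2
        linarith
    rw [Finset.prod_mul_distrib, Finset.prod_const, Finset.card_range,
      Finset.prod_range_reflect (fun i => (1 - (1 / 2 : ℝ) ^ (i + 1)))] at h1
    have h4 := quarter_le_prod_one_sub_half_pow d
    have : (x : ℝ) ^ d * (1 / 4) ≤ (x : ℝ) ^ d * ∏ i ∈ Finset.range d, (1 - (1 / 2 : ℝ) ^ (i + 1)) :=
      mul_le_mul_of_nonneg_left h4 (by positivity)
    linarith
  have hcast : ((∏ i ∈ Finset.range d, (x - q ^ (j + i)) : ℕ) : ℝ) =
      ∏ i ∈ Finset.range d, ((x : ℝ) - (q : ℝ) ^ (j + i)) := by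
    rw [Nat.cast_prod]
    refine Finset.prod_congr rfl fun i hi => ?_
    rw [Nat.cast_sub (hle i hi)]
    push_cast
    rfl
  rw [← hcast] at hreal
  exact_mod_cast hreal

section Counting

variable {F : Type} [Field F] {E : Type} [AddCommGroup E] [Module F E]

open Module Submodule

theorem AddMonoidHom.card_ker_mul_card_range {A B : Type} [AddGroup A] [AddGroup B] (f : A →+ B) :
    Nat.card f.ker * Nat.card f.range = Nat.card A := by
  rw [← AddSubgroup.index_ker, AddSubgroup.card_mul_index]

/-- The additive map `v ↦ ∑ a i • v i + ∑ b i • g (v i)`. -/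
def combHom (g : E →+ E) {r : ℕ} (a b : Fin r → F) : (Fin r → E) →+ E :=
  AddMonoidHom.mk' (fun v => ∑ i, a i • v i + ∑ i, b i • g (v i)) (by
    intro v w
    simp only [Pi.add_apply, smul_add, map_add, Finset.sum_add_distrib]
    abel)

theorem exists_combHom_eq_zero {g : E →+ E} {r : ℕ} {v : Fin r → E}
    (hv : ¬ LinearIndependent F (Sum.elim v (fun i => g (v i)))) :
    ∃ ab : (Fin r → F) × (Fin r → F), ab ≠ 0 ∧ combHom g ab.1 ab.2 v = 0 := by
  rw [Fintype.linearIndependent_iff] at hv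
  push Not at hv
  obtain ⟨c, hc, i, hi⟩ := hv
  refine ⟨(fun i => c (Sum.inl i), fun i => c (Sum.inr i)), ?_, ?_⟩
  · intro h
    rw [Prod.mk_eq_zero] at h
    rcases i with i | i
    · exact hi (congrFun h.1 i)
    · exact hi (congrFun h.2 i)
  · rw [Fintype.sum_sum_type] at hc
    exact hc

theorem exists_eigenvalue_of_comb {g : E →+ E} {a b : F} (hab : a ≠ 0 ∨ b ≠ 0) :
    ∃ c : F, ∀ x : E, a • x + b • g x = 0 → g x = c • x := by
  by_cases hb : b = 0
  · have ha : a ≠ 0 := by tauto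
    refine ⟨0, fun x hx => ?_⟩
    rw [hb, zero_smul, add_zero] at hx
    simp [(smul_eq_zero.1 hx).resolve_left ha]
  · refine ⟨-(b⁻¹ * a), fun x hx => ?_⟩
    have h := congrArg (fun y => b⁻¹ • y) hx
    simp only [smul_add, smul_smul, inv_mul_cancel₀ hb, one_smul, smul_zero] at h
    rw [neg_smul]
    exact eq_neg_of_add_eq_zero_right h

/-- Restriction of an additive endomorphism to an invariant subspace. -/
def restrictHom (g : E →+ E) (V : Submodule F E) (hV : ∀ x ∈ V, g x ∈ V) : V →+ V :=
  AddMonoidHom.mk' (fun x => ⟨g x, hV x x.2⟩) (fun x y => Subtype.ext (by simp))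

theorem linearIndependent_restrictHom (g : E →+ E) (V : Submodule F E) (hV : ∀ x ∈ V, g x ∈ V)
    {r : ℕ} (v : Fin r → V) :
    LinearIndependent F (Sum.elim v (fun i => restrictHom g V hV (v i))) ↔
      LinearIndependent F (Sum.elim (fun i => (v i : E)) (fun i => g (v i))) := by
  rw [← LinearMap.linearIndependent_iff V.subtype (Submodule.ker_subtype V), Sum.comp_elim]
  rfl

variable [Fintype E]

open Classical in
theorem card_eigen_restrictHom (g : E →+ E) (V : Submodule F E) (hV : ∀ x ∈ V, g x ∈ V) (c : F) :
    Nat.card {x : V // restrictHom g V hV x = c • x} =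
      ((Finset.univ.filter (fun x : E => g x = c • x)).filter (fun x => x ∈ V)).card := by
  rw [Finset.filter_filter, ← Fintype.card_subtype, ← Nat.card_eq_fintype_card]
  refine Nat.card_congr
    { toFun := fun x => ⟨x.1.1, congrArg Subtype.val x.2, x.1.2⟩
      invFun := fun x => ⟨⟨x.1, x.2.2⟩, Subtype.ext x.2.1⟩
      left_inv := fun x => rfl
      right_inv := fun x => rfl }

theorem card_comb_ker_mul_le {g : E →+ E} {M : ℕ} (hM : ∀ c : F,
    Nat.card {x : E // g x = c • x} * M ≤ Fintype.card E) {a b : F} (hab : a ≠ 0 ∨ b ≠ 0) :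
    Nat.card {x : E // a • x + b • g x = 0} * M ≤ Fintype.card E := by
  obtain ⟨c, hc⟩ := exists_eigenvalue_of_comb (g := g) hab
  exact le_trans (Nat.mul_le_mul_right _ (Nat.card_le_card_of_injective (Subtype.map id hc)
    (Subtype.map_injective hc Function.injective_id))) (hM c)

theorem card_combHom_ker_mul_le {g : E →+ E} {M : ℕ} (hM : ∀ c : F,
    Nat.card {x : E // g x = c • x} * M ≤ Fintype.card E) {r : ℕ} {a b : Fin r → F}
    (hab : (a, b) ≠ 0) :
    Nat.card (combHom g a b).ker * M ≤ Fintype.card E ^ r := by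
  obtain ⟨i, hi⟩ : ∃ i, a i ≠ 0 ∨ b i ≠ 0 := by
    by_contra! h
    exact hab (by rw [Prod.mk_eq_zero]; exact ⟨funext fun i => (h i).1, funext fun i => (h i).2⟩)
  have hE : Nat.card (Fin r → E) = Fintype.card E ^ r := by
    rw [Nat.card_eq_fintype_card, Fintype.card_fun, Fintype.card_fin]
  rw [← hE, ← AddMonoidHom.card_ker_mul_card_range (combHom g a b)]
  refine Nat.mul_le_mul_left _ ?_
  let ψ : E →+ E := (combHom g a b).comp (AddMonoidHom.single (fun _ : Fin r => E) i)
  have hψ : ∀ x, ψ x = a i • x + b i • g x := by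
    intro x
    simp only [ψ, combHom, AddMonoidHom.comp_apply, AddMonoidHom.mk'_apply,
      AddMonoidHom.single_apply]
    congr 1
    · rw [Finset.sum_eq_single i]
      · simp
      · intro j _ hj; simp [Pi.single_eq_of_ne hj]
      · simp
    · rw [Finset.sum_eq_single i]
      · simp
      · intro j _ hj; simp [Pi.single_eq_of_ne hj]
      · simp
  have h1 := card_comb_ker_mul_le hM hi
  have h2 := AddMonoidHom.card_ker_mul_card_range ψ
  have h3 : Nat.card ψ.ker = Nat.card {x : E // a i • x + b i • g x = 0} :=
    Nat.card_congr (Equiv.subtypeEquivRight fun x => by rw [AddMonoidHom.mem_ker, hψ])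
  rw [← h3, ← Nat.card_eq_fintype_card, ← h2] at h1
  have h4 : M ≤ Nat.card ψ.range := Nat.le_of_mul_le_mul_left h1 Nat.card_pos
  refine h4.trans ?_
  refine AddSubgroup.card_le_of_le ?_
  rintro _ ⟨y, rfl⟩
  exact ⟨_, rfl⟩

variable [Fintype F]

open Classical in
theorem card_filter_mem_submodule (U : Submodule F E) :
    (Finset.univ.filter (fun x : E => x ∈ U)).card = Fintype.card F ^ finrank F U := by
  rw [← Module.card_eq_pow_finrank (K := F) (V := U), Fintype.card_subtype]

open Classical in
/-- Greedy count of the tuples from `X` that are linearly independent modulo `U`. -/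
theorem prod_sub_le_card_independent_mod (X : Finset E) (d : ℕ) :
    ∀ U : Submodule F E,
      ∏ i ∈ Finset.range d, (X.card - Fintype.card F ^ (finrank F U + i)) ≤
        ((Fintype.piFinset fun _ : Fin d => X).filter
          (fun w => finrank F (U ⊔ span F (Set.range w) : Submodule F E) =
            finrank F U + d)).card := by
  induction d with
  | zero =>
    intro U
    simp only [Finset.range_zero, Finset.prod_empty]
    refine Finset.card_pos.2 ⟨Fin.elim0, ?_⟩
    rw [Finset.mem_filter, Fintype.mem_piFinset, Set.range_eq_empty, span_empty, sup_bot_eq]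
    exact ⟨fun i => i.elim0, rfl⟩
  | succ d ih =>
    intro U
    rw [Finset.prod_range_succ', mul_comm]
    set S : Finset (Σ _ : E, (Fin d → E)) :=
      (X.filter (fun x => x ∉ U)).sigma (fun x =>
        (Fintype.piFinset fun _ : Fin d => X).filter
          (fun w => finrank F ((U ⊔ span F {x}) ⊔ span F (Set.range w) : Submodule F E) =
            finrank F (U ⊔ span F {x} : Submodule F E) + d)) with hS
    have h1 : X.card - Fintype.card F ^ (finrank F U + 0) ≤
        (X.filter (fun x => x ∉ U)).card := by
      rw [add_zero, ← card_filter_mem_submodule U]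
      have h := Finset.card_filter_add_card_filter_not (s := X) (fun x => x ∈ U)
      have h' : (X.filter (fun x => x ∈ U)).card ≤
          (Finset.univ.filter (fun x : E => x ∈ U)).card :=
        Finset.card_le_card (Finset.filter_subset_filter _ (Finset.subset_univ X))
      omega
    have h2 : (X.card - Fintype.card F ^ (finrank F U + 0)) *
        ∏ i ∈ Finset.range d, (X.card - Fintype.card F ^ (finrank F U + (i + 1))) ≤ S.card := by
      rw [hS, Finset.card_sigma]
      refine le_trans (Nat.mul_le_mul_right _ h1) ?_
      rw [← smul_eq_mul]
      refine Finset.card_nsmul_le_sum _ _ _ fun x hx => ?_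
      have hxU := (Finset.mem_filter.1 hx).2
      have h3 := ih (U ⊔ span F {x})
      rw [Submodule.finrank_sup_span_singleton hxU] at h3
      rw [Submodule.finrank_sup_span_singleton hxU]
      refine le_trans (le_of_eq (Finset.prod_congr rfl fun i _ => ?_)) h3
      rw [add_assoc, add_comm 1 i]
    refine h2.trans ?_
    refine Finset.card_le_card_of_injOn (fun p => Fin.cons p.1 p.2) ?_ ?_
    · rintro ⟨x, w⟩ hp
      simp only [hS, Finset.coe_sigma, Set.mem_sigma_iff, Finset.mem_coe, Finset.mem_filter,
        Fintype.mem_piFinset] at hp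
      obtain ⟨⟨hxX, hxU⟩, hw, hf⟩ := hp
      simp only [Finset.mem_coe, Finset.mem_filter, Fintype.mem_piFinset]
      refine ⟨fun i => Fin.cases hxX hw i, ?_⟩
      rw [Fin.range_cons, Set.insert_eq, span_union, ← sup_assoc, hf,
        Submodule.finrank_sup_span_singleton hxU]
      omega
    · rintro ⟨x, w⟩ _ ⟨y, z⟩ _ h
      obtain ⟨rfl, rfl⟩ := Fin.cons_inj.1 h
      rfl

open Classical in
theorem pow_le_four_mul_card_independent_mod (X : Finset E) (U : Submodule F E) {d : ℕ}
    (hX : Fintype.card F ^ (finrank F U + d) ≤ X.card) :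
    X.card ^ d ≤ 4 * ((Fintype.piFinset fun _ : Fin d => X).filter
      (fun w => finrank F (U ⊔ span F (Set.range w) : Submodule F E) = finrank F U + d)).card :=
  (pow_le_four_mul_prod_sub Fintype.one_lt_card hX).trans
    (Nat.mul_le_mul_left _ (prod_sub_le_card_independent_mod X d U))

open Classical in
theorem card_mul_le_mul_card_of_fibers {T S : Type} (Y : Finset S) (t : Finset T) (f : T → S)
    (L c : ℕ) (h : ∀ V ∈ Y, L ≤ c * (t.filter (fun x => f x = V)).card) :
    Y.card * L ≤ c * t.card := by
  calc Y.card * L ≤ ∑ V ∈ Y, c * (t.filter (fun x => f x = V)).card := by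
        rw [← smul_eq_mul]; exact Finset.card_nsmul_le_sum _ _ _ h
    _ = c * ∑ V ∈ Y, ((t.filter (fun x => f x ∈ Y)).filter (fun x => f x = V)).card := by
        rw [Finset.mul_sum]
        refine Finset.sum_congr rfl fun V hV => ?_
        congr 2
        ext x
        simp only [Finset.mem_filter]
        constructor
        · rintro ⟨a, rfl⟩; exact ⟨⟨a, hV⟩, rfl⟩
        · rintro ⟨⟨a, _⟩, b⟩; exact ⟨a, b⟩
    _ = c * (t.filter (fun x => f x ∈ Y)).card := by
        rw [Finset.card_eq_sum_card_fiberwise (s := t.filter (fun x => f x ∈ Y)) (t := Y)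
          (f := f) (fun x hx => (Finset.mem_filter.1 hx).2)]
    _ ≤ c * t.card := Nat.mul_le_mul_left _ (Finset.card_filter_le _ _)

open Classical in
theorem pow_le_four_mul_card_completions {U V : Submodule F E} (hUV : U ≤ V) {s : ℕ}
    (hs : finrank F U + s = finrank F V) :
    Fintype.card F ^ (finrank F V * s) ≤ 4 * (Finset.univ.filter (fun w : Fin s → E =>
      U ⊔ span F (Set.range w) = V)).card := by
  have hc := card_filter_mem_submodule V
  have h := pow_le_four_mul_card_independent_mod (Finset.univ.filter (fun x : E => x ∈ V)) U
    (d := s) (by rw [hc, hs])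
  rw [hc, ← pow_mul] at h
  refine h.trans (Nat.mul_le_mul_left _ (Finset.card_le_card fun w hw => ?_))
  simp only [Finset.mem_filter, Fintype.mem_piFinset, Finset.mem_univ, true_and] at hw ⊢
  refine Submodule.eq_of_le_of_finrank_eq (sup_le hUV (span_le.2 ?_)) (by rw [hw.2, hs])
  rintro _ ⟨i, rfl⟩
  exact hw.1 i

open Classical in
/-- Subspaces of dimension `k` are counted by choosing partial data `a ∈ A` spanning a subspace
`u a` of codimension `s`, and then completing it. -/
theorem card_mul_le_of_partial_spans {α : Type} (A : Finset α) (u : α → Submodule F E)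
    (Y : Finset (Submodule F E)) {k s L c : ℕ}
    (hY : ∀ V ∈ Y, finrank F V = k ∧
      L ≤ c * (A.filter (fun a => u a ≤ V ∧ finrank F (u a) + s = k)).card) :
    Y.card * (L * Fintype.card F ^ (k * s)) ≤ c * 4 * (A.card * Fintype.card E ^ s) := by
  have ht : (A ×ˢ (Finset.univ : Finset (Fin s → E))).card = A.card * Fintype.card E ^ s := by
    rw [Finset.card_product, Finset.card_univ, Fintype.card_fun, Fintype.card_fin]
  rw [← ht]
  refine card_mul_le_mul_card_of_fibers Y _ (fun p => u p.1 ⊔ span F (Set.range p.2)) _ _ ?_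
  intro V hV
  obtain ⟨hVk, hL⟩ := hY V hV
  set B := A.filter (fun a => u a ≤ V ∧ finrank F (u a) + s = k) with hB
  set S : Finset (Σ _ : α, (Fin s → E)) := B.sigma (fun a =>
    Finset.univ.filter (fun w : Fin s → E => u a ⊔ span F (Set.range w) = V)) with hS
  have h1 : B.card * Fintype.card F ^ (k * s) ≤ 4 * S.card := by
    rw [hS, Finset.card_sigma, Finset.mul_sum, ← smul_eq_mul]
    refine Finset.card_nsmul_le_sum _ _ _ fun a ha => ?_
    obtain ⟨_, h2, h3⟩ := Finset.mem_filter.1 ha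
    have := pow_le_four_mul_card_completions h2 (s := s) (by rw [h3, hVk])
    rwa [hVk] at this
  have h2 : S.card ≤ ((A ×ˢ (Finset.univ : Finset (Fin s → E))).filter
      (fun p => u p.1 ⊔ span F (Set.range p.2) = V)).card := by
    refine Finset.card_le_card_of_injOn (fun p => (p.1, p.2)) ?_ ?_
    · rintro ⟨a, w⟩ hp
      simp only [hS, hB, Finset.coe_sigma, Set.mem_sigma_iff, Finset.mem_coe,
        Finset.mem_filter, Finset.mem_univ, true_and] at hp
      simp only [Finset.mem_coe, Finset.mem_filter, Finset.mem_product, Finset.mem_univ, and_true]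
      exact ⟨hp.1.1, hp.2⟩
    · rintro ⟨a, w⟩ _ ⟨b, z⟩ _ h
      simp only [Prod.mk.injEq] at h
      obtain ⟨rfl, rfl⟩ := h
      rfl
  calc
    L * Fintype.card F ^ (k * s) ≤ c * B.card * Fintype.card F ^ (k * s) :=
        Nat.mul_le_mul_right _ hL
    _ = c * (B.card * Fintype.card F ^ (k * s)) := by ring
    _ ≤ c * (4 * S.card) := Nat.mul_le_mul_left _ h1
    _ = c * 4 * S.card := by ring
    _ ≤ _ := by
        refine (Nat.mul_le_mul_left _ h2).trans (le_of_eq ?_)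
        congr!

open Classical in
/-- Few subspaces meet a given set `K` in many points. -/
theorem card_mul_le_of_large_inter (K : Finset E) (Y : Finset (Submodule F E)) {k d s : ℕ}
    (hk : d + s = k)
    (hY : ∀ V ∈ Y, finrank F V = k ∧
      Fintype.card F ^ d ≤ (K.filter (fun x => x ∈ V)).card) :
    Y.card * (Fintype.card F ^ (d * d) * Fintype.card F ^ (k * s)) ≤
      16 * (K.card ^ d * Fintype.card E ^ s) := by
  have h := card_mul_le_of_partial_spans (Fintype.piFinset fun _ : Fin d => K)
    (fun v => span F (Set.range v)) Y (k := k) (s := s) (L := Fintype.card F ^ (d * d)) (c := 4) ?_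
  · simpa [Fintype.card_piFinset] using h
  · intro V hV
    obtain ⟨hVk, hV2⟩ := hY V hV
    refine ⟨hVk, ?_⟩
    have h := pow_le_four_mul_card_independent_mod (K.filter (fun x => x ∈ V))
      (⊥ : Submodule F E) (d := d) (by simpa using hV2)
    rw [pow_mul]
    refine (Nat.pow_le_pow_left hV2 d).trans (h.trans (Nat.mul_le_mul_left _
      (Finset.card_le_card fun w hw => ?_)))
    simp only [Finset.mem_filter, Fintype.mem_piFinset, finrank_bot, zero_add] at hw ⊢
    rw [bot_sup_eq] at hw
    refine ⟨fun i => (hw.1 i).1, span_le.2 ?_, by omega⟩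
    rintro _ ⟨i, rfl⟩
    exact (hw.1 i).2

open Classical in
theorem card_mul_le_of_finrank_eq (Y : Finset (Submodule F E)) {k : ℕ}
    (hY : ∀ V ∈ Y, finrank F V = k) :
    Y.card * Fintype.card F ^ (k * k) ≤ 16 * Fintype.card E ^ k := by
  have h := card_mul_le_of_large_inter (F := F) (Finset.univ : Finset E) Y (zero_add k)
    (fun V hV => ⟨hY V hV, by
      rw [pow_zero]
      exact Finset.card_pos.2 ⟨0, by simp⟩⟩)
  simpa using h

open Classical in
/-- Few `g`-invariant subspaces contain many tuples `v` with `v`, `g ∘ v` jointly independent. -/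
theorem card_mul_le_of_many_independent_orbits (g : E → E) (Y : Finset (Submodule F E))
    {k r : ℕ} (hrk : 2 * r ≤ k)
    (hY : ∀ V ∈ Y, finrank F V = k ∧ (∀ x ∈ V, g x ∈ V) ∧
      Fintype.card F ^ (k * r) ≤ 4 * (Finset.univ.filter (fun v : Fin r → V =>
        LinearIndependent F (Sum.elim (fun i => (v i : E)) (fun i => g (v i))))).card) :
    Y.card * Fintype.card F ^ (k * (k - r)) ≤ 16 * Fintype.card E ^ (k - r) := by
  have h := card_mul_le_of_partial_spans (Finset.univ : Finset (Fin r → E))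
    (fun v => span F (Set.range (Sum.elim v (fun i => g (v i))))) Y (k := k) (s := k - 2 * r)
    (L := Fintype.card F ^ (k * r)) (c := 4) ?_
  · rw [Finset.card_univ, Fintype.card_fun, Fintype.card_fin, ← pow_add, ← pow_add,
      ← mul_add] at h
    rwa [show r + (k - 2 * r) = k - r by omega] at h
  · intro V hV
    obtain ⟨hVk, hVg, h⟩ := hY V hV
    refine ⟨hVk, h.trans (Nat.mul_le_mul_left _ ?_)⟩
    refine Finset.card_le_card_of_injOn (fun v i => (v i : E)) ?_ ?_
    · intro v hv
      simp only [Finset.mem_coe, Finset.mem_filter, Finset.mem_univ, true_and] at hv ⊢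
      refine ⟨span_le.2 ?_, ?_⟩
      · rintro _ ⟨i | i, rfl⟩
        · exact (v i).2
        · exact hVg _ (v i).2
      · rw [finrank_span_eq_card hv]
        simp only [Fintype.card_sum, Fintype.card_fin]
        omega
    · intro v _ w _ hvw
      funext i
      exact Subtype.ext (congrFun hvw i)

open Classical in
/-- If all eigenspaces of `g` are small, most `r`-tuples `v` are jointly independent of `g ∘ v`. -/
theorem many_independent_of_small_eigen {g : E →+ E} {r : ℕ} (hM : ∀ c : F,
    Nat.card {x : E // g x = c • x} * Fintype.card F ^ (2 * r + 1) ≤ Fintype.card E) :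
    Fintype.card E ^ r ≤ 4 * (Finset.univ.filter (fun v : Fin r → E =>
        LinearIndependent F (Sum.elim v (fun i => g (v i))))).card := by
  set q := Fintype.card F with hq
  have hq2 : 2 ≤ q := Fintype.one_lt_card
  set G := Finset.univ.filter (fun v : Fin r → E =>
        LinearIndependent F (Sum.elim v (fun i => g (v i)))) with hG
  set B := Finset.univ.filter (fun v : Fin r → E =>
        ¬ LinearIndependent F (Sum.elim v (fun i => g (v i)))) with hB
  have hGB : G.card + B.card = Fintype.card E ^ r := by
    rw [hG, hB, Finset.card_filter_add_card_filter_not, Finset.card_univ, Fintype.card_fun,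
      Fintype.card_fin]
  have h1 : B.card * q ^ (2 * r + 1) ≤ q ^ (2 * r) * Fintype.card E ^ r := by
    have hsub : B ⊆ (Finset.univ.filter (fun ab : (Fin r → F) × (Fin r → F) => ab ≠ 0)).biUnion
        (fun ab => Finset.univ.filter (fun v => combHom g ab.1 ab.2 v = 0)) := by
      intro v hv
      obtain ⟨ab, h, h'⟩ := exists_combHom_eq_zero (Finset.mem_filter.1 hv).2
      simp only [Finset.mem_biUnion, Finset.mem_filter, Finset.mem_univ, true_and]
      exact ⟨ab, h, h'⟩
    have h2 := (Finset.card_le_card hsub).trans Finset.card_biUnion_le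
    refine (Nat.mul_le_mul_right _ h2).trans ?_
    rw [Finset.sum_mul]
    have hcard : (Finset.univ.filter (fun ab : (Fin r → F) × (Fin r → F) => ab ≠ 0)).card ≤
        q ^ (2 * r) := by
      refine (Finset.card_le_univ _).trans ?_
      rw [Fintype.card_prod, Fintype.card_fun, Fintype.card_fin, ← pow_add, two_mul]
    refine le_trans ?_ (Nat.mul_le_mul_right _ hcard)
    rw [← smul_eq_mul]
    refine Finset.sum_le_card_nsmul _ _ _ fun ab hab => ?_
    have := card_combHom_ker_mul_le hM (a := ab.1) (b := ab.2) (Finset.mem_filter.1 hab).2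
    refine le_trans (le_of_eq ?_) this
    rw [← Fintype.card_subtype, ← Nat.card_eq_fintype_card]
    rfl
  have h3 : B.card * q ≤ Fintype.card E ^ r := by
    have : q ^ (2 * r) * (B.card * q) ≤ q ^ (2 * r) * Fintype.card E ^ r := by
      calc _ = B.card * q ^ (2 * r + 1) := by ring
        _ ≤ _ := h1
    exact Nat.le_of_mul_le_mul_left this (by positivity)
  nlinarith

open Classical in
/-- If no eigenspace of `g` is everything and the space is large, a quarter of all vectors
are not eigenvectors. -/
theorem many_non_eigen {g : E →+ E} (hE : 16 * Fintype.card F ^ 2 ≤ Fintype.card E)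
    (hne : ∀ c : F, ∃ x : E, g x ≠ c • x) :
    Fintype.card E ≤ 4 * (Finset.univ.filter (fun v : Fin 1 → E =>
        LinearIndependent F (Sum.elim v (fun i => g (v i))))).card := by
  set q := Fintype.card F with hq
  set N := Fintype.card E with hN
  let K : F → AddSubgroup E := fun c =>
    { carrier := {x | g x = c • x}
      zero_mem' := by simp
      add_mem' := by
        intro x y hx hy
        change g (x + y) = c • (x + y)
        rw [map_add, smul_add, (show g x = c • x from hx), (show g y = c • y from hy)]
      neg_mem' := by
        intro x hx
        change g (-x) = c • (-x)
        rw [map_neg, smul_neg, (show g x = c • x from hx)] }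
  have hK : ∀ c x, x ∈ K c ↔ g x = c • x := fun c x => Iff.rfl
  have hNn : Nat.card E = N := Nat.card_eq_fintype_card
  have hhalf : ∀ c, 2 * Nat.card (K c) ≤ N := by
    intro c
    have h1 : Nat.card (K c) * (K c).index = N := by rw [AddSubgroup.card_mul_index, hNn]
    have h2 : (K c).index ≠ 1 := by
      intro h
      rw [AddSubgroup.index_eq_one] at h
      obtain ⟨x, hx⟩ := hne c
      exact hx ((hK c x).1 (h ▸ AddSubgroup.mem_top x))
    have h3 : (K c).index ≠ 0 := AddSubgroup.index_ne_zero_of_finite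
    have h4 : 2 ≤ (K c).index := by omega
    nlinarith
  have hprod : ∀ c d, c ≠ d → Nat.card (K c) * Nat.card (K d) ≤ N := by
    intro c d hcd
    rw [← Nat.card_prod, ← hNn]
    refine Nat.card_le_card_of_injective (fun p : K c × K d => (p.1 : E) + p.2) ?_
    rintro ⟨⟨x, hx⟩, ⟨y, hy⟩⟩ ⟨⟨x', hx'⟩, ⟨y', hy'⟩⟩ h
    have h1 : x - x' = y' - y := by
      have h : x + y = x' + y' := h
      rw [sub_eq_sub_iff_add_eq_add, h, add_comm]
    have h2 : x - x' ∈ K c := (K c).sub_mem hx hx'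
    have h3 : x - x' ∈ K d := h1 ▸ (K d).sub_mem hy' hy
    have h4 : (c - d) • (x - x') = 0 := by
      rw [sub_smul, ← (hK _ _).1 h2, ← (hK _ _).1 h3, sub_self]
    have h5 : x - x' = 0 := (smul_eq_zero.1 h4).resolve_left (sub_ne_zero.2 hcd)
    have h6 : y' - y = 0 := h1 ▸ h5
    have e1 := sub_eq_zero.1 h5
    have e2 := sub_eq_zero.1 h6
    subst e1 e2
    rfl
  obtain ⟨c₀, _, hc₀⟩ := Finset.exists_max_image (Finset.univ : Finset F)
    (fun c => Nat.card (K c)) ⟨0, Finset.mem_univ _⟩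
  have hsmall : ∀ c, c ≠ c₀ → 4 * (q * Nat.card (K c)) ≤ N := by
    intro c hc
    have h1 : Nat.card (K c) * Nat.card (K c) ≤ N :=
      (Nat.mul_le_mul_left _ (hc₀ c (Finset.mem_univ _))).trans (hprod c c₀ hc)
    by_contra! h
    have h2 : N * N < (4 * (q * Nat.card (K c))) * (4 * (q * Nat.card (K c))) :=
      Nat.mul_self_lt_mul_self h
    have h3 : (4 * (q * Nat.card (K c))) * (4 * (q * Nat.card (K c))) ≤ N * N := by
      calc _ = (16 * q ^ 2) * (Nat.card (K c) * Nat.card (K c)) := by ring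
        _ ≤ N * N := Nat.mul_le_mul hE h1
    omega
  set B := Finset.univ.filter (fun x : E => ∃ c : F, g x = c • x) with hB
  have hBcard : 4 * B.card ≤ 3 * N := by
    have hsub : B ⊆ (Finset.univ.filter (fun x : E => g x = c₀ • x)) ∪
        ((Finset.univ.erase c₀).biUnion (fun c => Finset.univ.filter (fun x : E => g x = c • x))) := by
      intro x hx
      obtain ⟨c, hc⟩ := (Finset.mem_filter.1 hx).2
      by_cases h : c = c₀
      · subst h
        exact Finset.mem_union_left _ (by simp [hc])
      · refine Finset.mem_union_right _ (Finset.mem_biUnion.2 ⟨c, by simp [h], by simp [hc]⟩)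
    have hcK : ∀ c, (Finset.univ.filter (fun x : E => g x = c • x)).card = Nat.card (K c) := by
      intro c
      rw [← Fintype.card_subtype, ← Nat.card_eq_fintype_card]
      rfl
    have h1 := (Finset.card_le_card hsub).trans (Finset.card_union_le _ _)
    have h2 : q * (4 * ((Finset.univ.erase c₀).biUnion
        (fun c => Finset.univ.filter (fun x : E => g x = c • x))).card) ≤ q * N := by
      have h3 : ((Finset.univ.erase c₀).biUnion
        (fun c => Finset.univ.filter (fun x : E => g x = c • x))).card ≤
          ∑ c ∈ Finset.univ.erase c₀, Nat.card (K c) := by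
        refine Finset.card_biUnion_le.trans (Finset.sum_le_sum fun c _ => (hcK c).le)
      have h4 : ∑ c ∈ Finset.univ.erase c₀, (4 * (q * Nat.card (K c))) ≤ q * N := by
        refine (Finset.sum_le_card_nsmul _ _ N fun c hc =>
          hsmall c (Finset.ne_of_mem_erase hc)).trans ?_
        rw [smul_eq_mul]
        exact Nat.mul_le_mul_right _ (Finset.card_le_univ _)
      rw [← Finset.mul_sum, ← Finset.mul_sum] at h4
      nlinarith
    have h5 := Nat.le_of_mul_le_mul_left h2 Fintype.card_pos
    rw [hcK] at h1
    have := hhalf c₀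
    omega
  have hcompl : (Finset.univ.filter (fun x : E => ¬ ∃ c : F, g x = c • x)).card + B.card = N := by
    rw [add_comm, hB, Finset.card_filter_add_card_filter_not, Finset.card_univ]
  have hle : (Finset.univ.filter (fun x : E => ¬ ∃ c : F, g x = c • x)).card ≤
      (Finset.univ.filter (fun v : Fin 1 → E =>
        LinearIndependent F (Sum.elim v (fun i => g (v i))))).card := by
    refine Finset.card_le_card_of_injOn (fun x _ => x) ?_ (fun x _ y _ h => congrFun h 0)
    intro x hx
    simp only [Finset.mem_coe, Finset.mem_filter, Finset.mem_univ, true_and] at hx ⊢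
    by_contra hli
    obtain ⟨⟨a, b⟩, hab, h⟩ := exists_combHom_eq_zero hli
    have h' : a 0 • x + b 0 • g x = 0 := by
      simpa [combHom] using h
    have hab' : a 0 ≠ 0 ∨ b 0 ≠ 0 := by
      by_contra! h0
      refine hab (Prod.mk_eq_zero.2 ⟨funext fun i => ?_, funext fun i => ?_⟩)
      · rw [Subsingleton.elim i 0]; exact h0.1
      · rw [Subsingleton.elim i 0]; exact h0.2
    obtain ⟨c, hc⟩ := exists_eigenvalue_of_comb (g := g) hab'
    exact hx ⟨c, hc x h'⟩
  omega

open Classical in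
/-- Bound on the number of `g`-invariant `k`-subspaces with saving `q ^ e`, provided the eigenspaces
of `g` have size at most `q ^ (n - m)`. -/
theorem card_invariant_mul_le (g : E →+ E) (Y : Finset (Submodule F E)) {k s r m e : ℕ}
    (hY : ∀ V ∈ Y, finrank F V = k ∧ (∀ x ∈ V, g x ∈ V))
    (hm : ∀ c : F, Nat.card {x : E // g x = c • x} * Fintype.card F ^ m ≤ Fintype.card E)
    (hk : k ≤ finrank F E) (hsk : s ≤ k) (hsm : s ≤ m) (hrk : 2 * r ≤ k)
    (he1 : e ≤ (m - s) * (k - s)) (he2 : e ≤ r * (finrank F E - k))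
    (hgood : ∀ V ∈ Y, (∀ c : F, ((Finset.univ.filter (fun x : E => g x = c • x)).filter
        (fun x => x ∈ V)).card < Fintype.card F ^ (k - s)) →
      Fintype.card F ^ (k * r) ≤ 4 * (Finset.univ.filter (fun v : Fin r → V =>
        LinearIndependent F (Sum.elim (fun i => (v i : E)) (fun i => g (v i))))).card) :
    Y.card * Fintype.card F ^ (k * k + e) ≤
      16 * (Fintype.card F + 1) * Fintype.card F ^ (finrank F E * k) := by
  have hE : Fintype.card E = Fintype.card F ^ finrank F E := Module.card_eq_pow_finrank
  set q := Fintype.card F with hq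
  have hq0 : 0 < q := Fintype.card_pos
  obtain ⟨d, rfl⟩ := Nat.exists_eq_add_of_le' hsk
  obtain ⟨m', rfl⟩ := Nat.exists_eq_add_of_le' hsm
  obtain ⟨n', hn'⟩ := Nat.exists_eq_add_of_le' hk
  simp only [Nat.add_sub_cancel] at he1 hgood
  rw [hn'] at he2
  simp only [Nat.add_sub_cancel] at he2
  let K : F → Finset E := fun c => Finset.univ.filter (fun x : E => g x = c • x)
  let B : F → Finset (Submodule F E) := fun c =>
    Y.filter (fun V => q ^ d ≤ ((K c).filter (fun x => x ∈ V)).card)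
  let A : Finset (Submodule F E) :=
    Y.filter (fun V => ∀ c, ((K c).filter (fun x => x ∈ V)).card < q ^ d)
  have hsub : Y ⊆ Finset.univ.biUnion B ∪ A := by
    intro V hV
    by_cases h : ∀ c, ((K c).filter (fun x => x ∈ V)).card < q ^ d
    · exact Finset.mem_union_right _ (Finset.mem_filter.2 ⟨hV, h⟩)
    · push Not at h
      obtain ⟨c, hc⟩ := h
      exact Finset.mem_union_left _ (Finset.mem_biUnion.2 ⟨c, Finset.mem_univ _,
        Finset.mem_filter.2 ⟨hV, hc⟩⟩)
  have hBc : ∀ c, (B c).card * q ^ ((d + s) * (d + s) + e) ≤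
      16 * q ^ (finrank F E * (d + s)) := by
    intro c
    have h1 := card_mul_le_of_large_inter (K c) (B c) (d := d) (s := s) rfl (fun V hV =>
      ⟨(hY V (Finset.mem_filter.1 hV).1).1, (Finset.mem_filter.1 hV).2⟩)
    have h2 : (K c).card * q ^ (m' + s) ≤ q ^ finrank F E := by
      rw [← hE]
      convert hm c using 2
      rw [Nat.card_eq_fintype_card, Fintype.card_subtype]
    calc (B c).card * q ^ ((d + s) * (d + s) + e)
        ≤ (B c).card * q ^ ((d + s) * (d + s) + m' * d) := by gcongr
      _ = ((B c).card * (q ^ (d * d) * q ^ ((d + s) * s))) * (q ^ (m' + s)) ^ d := by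
          rw [mul_assoc]
          congr 1
          rw [← pow_mul, ← pow_add, ← pow_add]
          congr 1
          ring
      _ ≤ (16 * ((K c).card ^ d * Fintype.card E ^ s)) * (q ^ (m' + s)) ^ d :=
          Nat.mul_le_mul_right _ h1
      _ = 16 * (((K c).card * q ^ (m' + s)) ^ d * (q ^ finrank F E) ^ s) := by rw [hE]; ring
      _ ≤ 16 * ((q ^ finrank F E) ^ d * (q ^ finrank F E) ^ s) := by gcongr
      _ = _ := by rw [← pow_add, ← pow_mul]
  have hA : A.card * q ^ ((d + s) * (d + s) + e) ≤ 16 * q ^ (finrank F E * (d + s)) := by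
    have h1 := card_mul_le_of_many_independent_orbits g A hrk (fun V hV => by
      have h2 := Finset.mem_filter.1 hV
      exact ⟨(hY V h2.1).1, (hY V h2.1).2, hgood V h2.1 h2.2⟩)
    obtain ⟨t, ht⟩ := Nat.exists_eq_add_of_le' (show r ≤ d + s by omega)
    have ht' : d + s - r = t := by omega
    rw [ht', ← hq] at h1
    calc A.card * q ^ ((d + s) * (d + s) + e)
        ≤ A.card * q ^ ((d + s) * (d + s) + r * n') := by gcongr
      _ = A.card * q ^ ((d + s) * t) * (q ^ finrank F E) ^ r := by
          rw [mul_assoc]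
          congr 1
          rw [← pow_mul, ← pow_add, hn']
          congr 1
          nth_rewrite 2 [ht]
          ring
      _ ≤ 16 * Fintype.card E ^ t * (q ^ finrank F E) ^ r := Nat.mul_le_mul_right _ h1
      _ = _ := by
          rw [hE, mul_assoc, ← pow_add, ← pow_mul, ← ht]
  calc Y.card * q ^ ((d + s) * (d + s) + e)
      ≤ (∑ c, (B c).card + A.card) * q ^ ((d + s) * (d + s) + e) := by
        refine Nat.mul_le_mul_right _ ((Finset.card_le_card hsub).trans
          ((Finset.card_union_le _ _).trans (Nat.add_le_add_right Finset.card_biUnion_le _)))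
    _ = ∑ c, (B c).card * q ^ ((d + s) * (d + s) + e) + A.card * q ^ ((d + s) * (d + s) + e) := by
        rw [add_mul, Finset.sum_mul]
    _ ≤ q * (16 * q ^ (finrank F E * (d + s))) + 16 * q ^ (finrank F E * (d + s)) := by
        refine Nat.add_le_add ?_ hA
        refine (Finset.sum_le_card_nsmul _ _ _ fun c _ => hBc c).trans ?_
        rw [smul_eq_mul, Finset.card_univ]
    _ = _ := by ring

open Classical in
/-- For `k` in the middle range, eigenspaces of codimension at least `m ≥ 1` save `q ^ (m n / 128)`
in the number of invariant `k`-subspaces. -/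
theorem card_invariant_middle_mul_le (g : E →+ E) (Y : Finset (Submodule F E)) {k m e : ℕ}
    (hY : ∀ V ∈ Y, finrank F V = k ∧ (∀ x ∈ V, g x ∈ V))
    (hm : ∀ c : F, Nat.card {x : E // g x = c • x} * Fintype.card F ^ m ≤ Fintype.card E)
    (hm1 : 1 ≤ m) (hn : 32 ≤ finrank F E) (hk1 : finrank F E ≤ 4 * k)
    (hk2 : 4 * k ≤ 3 * finrank F E) (he : 128 * e ≤ m * finrank F E) :
    Y.card * Fintype.card F ^ (k * k + e) ≤
      16 * (Fintype.card F + 1) * Fintype.card F ^ (finrank F E * k) := by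
  have hE : Fintype.card E = Fintype.card F ^ finrank F E := Module.card_eq_pow_finrank
  have hq2 : 2 ≤ Fintype.card F := Fintype.one_lt_card
  have hmn : m ≤ finrank F E := by
    have h1 : 1 ≤ Nat.card {x : E // g x = (0 : F) • x} :=
      Nat.card_pos_iff.2 ⟨⟨⟨0, by simp⟩⟩, inferInstance⟩
    have h2 := hm 0
    rw [hE] at h2
    have h3 : Fintype.card F ^ m ≤ Fintype.card F ^ finrank F E :=
      le_trans (Nat.le_mul_of_pos_left _ h1) h2
    exact (Nat.pow_le_pow_iff_right hq2).1 h3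
  have hcardV : ∀ V ∈ Y, Fintype.card V = Fintype.card F ^ k := fun V hV => by
    rw [Module.card_eq_pow_finrank (K := F), (hY V hV).1]
  rcases lt_or_ge m 16 with hm16 | hm16
  · refine card_invariant_mul_le g Y (s := 0) (r := 1) hY hm (by omega) (by omega) (by omega)
      (by omega) ?_ ?_ ?_
    · have : m * finrank F E ≤ m * (4 * k) := Nat.mul_le_mul_left _ hk1
      rw [Nat.sub_zero, Nat.sub_zero]
      nlinarith
    · have : m * finrank F E ≤ 16 * finrank F E := Nat.mul_le_mul_right _ hm16.le
      omega
    · intro V hV hsmall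
      rw [mul_one, ← hcardV V hV]
      refine (many_non_eigen (F := F) (E := V)
        (g := restrictHom g V (hY V hV).2) ?_ ?_).trans (le_of_eq ?_)
      · rw [hcardV V hV]
        calc 16 * Fintype.card F ^ 2 = 2 ^ 4 * Fintype.card F ^ 2 := by norm_num
          _ ≤ Fintype.card F ^ 4 * Fintype.card F ^ 2 := by gcongr
          _ = Fintype.card F ^ 6 := by rw [← pow_add]
          _ ≤ Fintype.card F ^ k := Nat.pow_le_pow_right (by omega) (by omega)
      · intro c
        by_contra! h
        have h1 := hsmall c
        rw [← card_eigen_restrictHom g V (hY V hV).2 c, Nat.sub_zero, ← hcardV V hV,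
          ← Nat.card_eq_fintype_card] at h1
        exact absurd (Nat.card_congr (Equiv.subtypeUnivEquiv h)) h1.ne
      · congr! 3
        rw [linearIndependent_restrictHom]
  · have hr : 32 * (m / 16) ≥ m := by omega
    refine card_invariant_mul_le g Y (s := 2 * (m / 16) + 1) (r := m / 16) hY hm (by omega)
      (by omega) (by omega) (by omega) ?_ ?_ ?_
    · have h1 : m ≤ 2 * (m - (2 * (m / 16) + 1)) := by omega
      have h2 : finrank F E ≤ 16 * (k - (2 * (m / 16) + 1)) := by omega
      have := Nat.mul_le_mul h1 h2
      nlinarith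
    · have h2 : finrank F E ≤ 4 * (finrank F E - k) := by omega
      have := Nat.mul_le_mul hr h2
      nlinarith
    · intro V hV hsmall
      rw [pow_mul, ← hcardV V hV]
      refine (many_independent_of_small_eigen (F := F) (E := V)
        (g := restrictHom g V (hY V hV).2) ?_).trans
        (le_of_eq ?_)
      · intro c
        rw [card_eigen_restrictHom]
        refine (Nat.mul_le_mul_right _ (hsmall c).le).trans (le_of_eq ?_)
        rw [← pow_add, hcardV V hV]
        congr 1
        omega
      · congr! 3
        rw [linearIndependent_restrictHom]

end Counting

section Grassmannian

variable {F : Type} [Field F] [Fintype F] {E : Type} [AddCommGroup E] [Module F E] [Fintype E]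

open Module Submodule

theorem natCard_finrank_eq_mul {k : ℕ} (hk : k ≤ finrank F E) :
    Nat.card {V : Submodule F E // finrank F V = k} *
        ∏ i : Fin k, (Fintype.card F ^ k - Fintype.card F ^ (i : ℕ)) =
      ∏ i : Fin k, (Fintype.card F ^ finrank F E - Fintype.card F ^ (i : ℕ)) := by
  rw [← card_linearIndependent hk]
  let f : (Σ V : {V : Submodule F E // finrank F V = k},
      {s : Fin k → V.1 // LinearIndependent F s}) → {s : Fin k → E // LinearIndependent F s} :=
    fun p => ⟨fun i => (p.2.1 i : E), p.2.2.map' p.1.1.subtype (Submodule.ker_subtype _)⟩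
  have hspan : ∀ (V : {V : Submodule F E // finrank F V = k})
      (s : {s : Fin k → V.1 // LinearIndependent F s}),
      span F (Set.range fun i => (s.1 i : E)) = V.1 := by
    intro V s
    refine Submodule.eq_of_le_of_finrank_eq (span_le.2 ?_) ?_
    · rintro _ ⟨i, rfl⟩
      exact (s.1 i).2
    · have h := s.2.map' V.1.subtype (Submodule.ker_subtype _)
      have h2 := finrank_span_eq_card h
      rw [Fintype.card_fin] at h2
      rw [V.2]
      exact h2
  have hf : Function.Bijective f := by
    constructor
    · rintro ⟨V, s⟩ ⟨W, t⟩ h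
      have h1 : (fun i => (s.1 i : E)) = fun i => (t.1 i : E) := congrArg Subtype.val h
      have h2 : V = W := by
        apply Subtype.ext
        rw [← hspan V s, h1, hspan W t]
      subst h2
      congr 1
      apply Subtype.ext
      funext i
      exact Subtype.ext (congrFun h1 i)
    · rintro ⟨s, hs⟩
      refine ⟨⟨⟨span F (Set.range s), by rw [finrank_span_eq_card hs, Fintype.card_fin]⟩,
        ⟨fun i => ⟨s i, subset_span ⟨i, rfl⟩⟩, ?_⟩⟩, rfl⟩
      exact LinearIndependent.of_comp (Submodule.subtype _) hs
  rw [← Nat.card_congr (Equiv.ofBijective f hf), Nat.card_sigma]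
  have h3 : ∀ V : {V : Submodule F E // finrank F V = k},
      Nat.card {s : Fin k → V.1 // LinearIndependent F s} =
        ∏ i : Fin k, (Fintype.card F ^ k - Fintype.card F ^ (i : ℕ)) := by
    rintro ⟨V, rfl⟩
    rw [card_linearIndependent le_rfl]
  rw [Finset.sum_congr rfl fun V _ => h3 V, Finset.sum_const, smul_eq_mul, Finset.card_univ]
  congr 1
  exact Nat.card_eq_fintype_card

end Grassmannian

theorem qBinom_mul_eq {q n k : ℕ} (hq : 2 ≤ q) (hk : k ≤ n) :
    qBinom q n k * ∏ i : Fin k, ((q : ℝ) ^ k - (q : ℝ) ^ (i : ℕ)) =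
      ∏ i : Fin k, ((q : ℝ) ^ n - (q : ℝ) ^ (i : ℕ)) := by
  rw [qBinom, Finset.prod_range, ← Finset.prod_mul_distrib]
  refine Finset.prod_congr rfl fun i _ => ?_
  have hi := i.2
  have hq1 : (1 : ℝ) < q := by exact_mod_cast hq
  have h1 : (q : ℝ) ^ (k - (i : ℕ)) - 1 ≠ 0 := by
    have := one_lt_pow₀ hq1 (show k - (i : ℕ) ≠ 0 by omega)
    linarith
  have h2 : (q : ℝ) ^ k = q ^ (k - (i : ℕ)) * q ^ (i : ℕ) := by
    rw [← pow_add]; congr 1; omega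
  have h3 : (q : ℝ) ^ n = q ^ (n - (i : ℕ)) * q ^ (i : ℕ) := by
    rw [← pow_add]; congr 1; omega
  rw [h2, h3]
  field_simp

theorem qBinom_eq_natCard {F : Type} [Field F] [Fintype F] {n k : ℕ} (hk : k ≤ n) :
    qBinom (Fintype.card F) n k =
      Nat.card {V : Submodule F (Fin n → F) // Module.finrank F V = k} := by
  have hq : 2 ≤ Fintype.card F := Fintype.one_lt_card
  have hq1 : (1 : ℝ) < Fintype.card F := by exact_mod_cast hq
  have h := natCard_finrank_eq_mul (F := F) (E := Fin n → F) (k := k) (by simpa using hk)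
  rw [Module.finrank_fintype_fun_eq_card, Fintype.card_fin] at h
  have h2 := congrArg (Nat.cast : ℕ → ℝ) h
  push_cast at h2
  have hcast : ∀ N, k ≤ N → ∏ i : Fin k,
      (((Fintype.card F ^ N - Fintype.card F ^ (i : ℕ) : ℕ)) : ℝ) =
      ∏ i : Fin k, ((Fintype.card F : ℝ) ^ N - (Fintype.card F : ℝ) ^ (i : ℕ)) := by
    intro N hN
    refine Finset.prod_congr rfl fun i _ => ?_
    rw [Nat.cast_sub (Nat.pow_le_pow_right (by omega) (by have := i.2; omega))]
    push_cast
    rfl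
  rw [hcast k le_rfl, hcast n hk, ← qBinom_mul_eq hq hk] at h2
  refine (mul_right_cancel₀ ?_ h2).symm
  refine Finset.prod_ne_zero_iff.2 fun i _ => ?_
  have := pow_lt_pow_right₀ hq1 i.2
  linarith

theorem pow_le_qBinom {q n k : ℕ} (hq : 2 ≤ q) (hk : k ≤ n) :
    (q : ℝ) ^ (k * (n - k)) ≤ qBinom q n k := by
  have hq1 : (1 : ℝ) < q := by exact_mod_cast hq
  rw [qBinom, mul_comm, pow_mul, ← Finset.card_range k, ← Finset.prod_const, Finset.card_range]
  refine Finset.prod_le_prod (fun _ _ => by positivity) fun j hj => ?_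
  have hj' := Finset.mem_range.1 hj
  have h1 : (1 : ℝ) < q ^ (k - j) := one_lt_pow₀ hq1 (by omega)
  rw [le_div_iff₀ (by linarith), mul_sub, ← pow_add, show n - k + (k - j) = n - j by omega]
  have : (1 : ℝ) ≤ q ^ (n - k) := one_le_pow₀ hq1.le
  linarith

theorem natCard_submodule_eq_sum {F : Type} [Field F] [Fintype F] {n : ℕ}
    (P : Submodule F (Fin n → F) → Prop) :
    Nat.card {V : Submodule F (Fin n → F) // P V} =
      ∑ k ∈ Finset.range (n + 1), Nat.card
        {V : Submodule F (Fin n → F) // Module.finrank F V = k ∧ P V} := by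
  classical
  have : Fintype (Submodule F (Fin n → F)) := Fintype.ofFinite _
  simp only [Nat.card_eq_fintype_card, Fintype.card_subtype]
  rw [Finset.card_eq_sum_card_fiberwise (f := fun V : Submodule F (Fin n → F) => Module.finrank F V)
    (t := Finset.range (n + 1))]
  · refine Finset.sum_congr rfl fun k _ => ?_
    rw [Finset.filter_filter]
    congr 1
    ext V
    simp only [Finset.mem_filter, and_comm]
  · intro V _
    have := Submodule.finrank_le V
    simp only [Module.finrank_fintype_fun_eq_card, Fintype.card_fin] at this
    simpa using Nat.lt_succ_of_le this

theorem Sq_eq_natCard {F : Type} [Field F] [Fintype F] (n : ℕ) :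
    Sq (Fintype.card F) n = Nat.card (Submodule F (Fin n → F)) := by
  have h := natCard_submodule_eq_sum (F := F) (n := n) (fun _ => True)
  rw [Nat.card_congr (Equiv.subtypeUnivEquiv fun _ => trivial)] at h
  rw [h, Sq, Nat.cast_sum]
  refine Finset.sum_congr rfl fun k hk => ?_
  rw [qBinom_eq_natCard (by have := Finset.mem_range.1 hk; omega)]
  simp only [and_true]

theorem sum_comp_le_sum_of_injective {α β : Type*} {s : α → β} (hs : Function.Injective s)
    {A : Finset α} {B : Finset β} (hAB : ∀ a ∈ A, s a ∈ B) {f : β → ℕ} :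
    ∑ a ∈ A, f (s a) ≤ ∑ b ∈ B, f b := by
  refine (Finset.sum_map A ⟨s, hs⟩ f).symm.trans_le ?_
  refine Finset.sum_le_sum_of_subset fun b hb => ?_
  obtain ⟨a, ha, rfl⟩ := Finset.mem_map.1 hb
  exact hAB a ha

/-- The orbit-counting lemma, separating the contribution of elements that act trivially. -/
theorem natCard_orbits_mul_natCard_group {G X : Type*} [Group G] [Fintype G] [Finite X]
    [MulAction G X] (Z : Finset G) (hZ : ∀ g ∈ Z, ∀ x : X, g • x = x) [DecidableEq G] :
    Nat.card (Quotient (MulAction.orbitRel G X)) * Nat.card G =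
      Z.card * Nat.card X + ∑ g ∈ Zᶜ, Nat.card (MulAction.fixedBy X g) := by
  classical
  have : Fintype X := Fintype.ofFinite X
  have h := MulAction.sum_card_fixedBy_eq_card_orbits_mul_card_group G X
  simp only [← Nat.card_eq_fintype_card] at h
  rw [← h, ← Finset.sum_add_sum_compl Z, Finset.sum_congr rfl (g := fun _ => Nat.card X),
    Finset.sum_const, smul_eq_mul]
  intro g hg
  exact Nat.card_congr (Equiv.subtypeUnivEquiv fun x => hZ g hg x)

section SemiMonomial

variable {F : Type} [Field F] {n : ℕ}

/-- The semilinear monomial map `x ↦ (dᵢ σ(x_{π i}))ᵢ`. -/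
def monomialHom (σ : F ≃+* F) (π : Equiv.Perm (Fin n)) (d : Fin n → Fˣ) :
    (Fin n → F) →+ (Fin n → F) where
  toFun x i := d i * σ (x (π i))
  map_zero' := by ext i; simp
  map_add' x y := by ext i; simp [mul_add]

theorem monomialHom_apply (σ : F ≃+* F) (π : Equiv.Perm (Fin n)) (d : Fin n → Fˣ)
    (x : Fin n → F) (i : Fin n) : monomialHom σ π d x i = d i * σ (x (π i)) := rfl

/-- The number of subspaces that are mapped into themselves by `g`. -/
noncomputable def invariantCount (g : (Fin n → F) →+ (Fin n → F)) : ℕ :=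
  Nat.card {V : Submodule F (Fin n → F) // ∀ x ∈ V, g x ∈ V}

variable (F n) in
/-- The group of all semilinear monomial transformations of `F ^ n`. -/
def semiMonomial : Subgroup (Equiv.Perm (Fin n → F)) where
  carrier := {f | ∃ σ π d, ∀ x, f x = monomialHom σ π d x}
  one_mem' := ⟨RingEquiv.refl F, 1, 1, fun x => by ext i; simp [monomialHom_apply]⟩
  mul_mem' := by
    rintro f g ⟨σ, π, d, hf⟩ ⟨τ, ρ, e, hg⟩
    refine ⟨τ.trans σ, ρ * π, fun i => d i * Units.map (σ : F →* F) (e (π i)), fun x => ?_⟩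
    ext i
    rw [Equiv.Perm.mul_apply, hf, hg]
    simp [monomialHom_apply, mul_assoc]
  inv_mem' := by
    rintro f ⟨σ, π, d, hf⟩
    refine ⟨σ.symm, π⁻¹, fun i => Units.map (σ.symm : F →* F) (d (π⁻¹ i))⁻¹, fun x => ?_⟩
    apply f.injective
    rw [show f (f⁻¹ x) = x from f.apply_symm_apply x, hf]
    ext i
    simp [monomialHom_apply]

/-- The image of a subspace under a semilinear monomial transformation. -/
def semiMonomialMap (f : semiMonomial F n) (V : Submodule F (Fin n → F)) :
    Submodule F (Fin n → F) where
  carrier := f.1 '' V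
  zero_mem' := by
    obtain ⟨σ, π, d, hf⟩ := f.2
    exact ⟨0, V.zero_mem, by simp [hf]⟩
  add_mem' := by
    rintro _ _ ⟨x, hx, rfl⟩ ⟨y, hy, rfl⟩
    obtain ⟨σ, π, d, hf⟩ := f.2
    exact ⟨x + y, V.add_mem hx hy, by simp [hf]⟩
  smul_mem' := by
    rintro a _ ⟨x, hx, rfl⟩
    obtain ⟨σ, π, d, hf⟩ := f.2
    refine ⟨σ.symm a • x, V.smul_mem _ hx, ?_⟩
    ext i
    simp [hf, monomialHom_apply, mul_left_comm]

instance : MulAction (semiMonomial F n) (Submodule F (Fin n → F)) where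
  smul f V := semiMonomialMap f V
  one_smul V := SetLike.coe_injective (by
    change (fun x => x) '' (V : Set (Fin n → F)) = V
    simp)
  mul_smul f g V := SetLike.coe_injective (by
    change (fun x => f.1 (g.1 x)) '' (V : Set (Fin n → F)) = f.1 '' (g.1 '' V)
    rw [Set.image_image])

theorem semiMonomial.coe_smul (f : semiMonomial F n) (V : Submodule F (Fin n → F)) :
    ((f • V : Submodule F (Fin n → F)) : Set (Fin n → F)) = f.1 '' V := rfl

theorem semiMonomial.finrank_smul [Fintype F] (f : semiMonomial F n)
    (V : Submodule F (Fin n → F)) :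
    Module.finrank F (f • V : Submodule F (Fin n → F)) = Module.finrank F V := by
  have h : Nat.card (f • V : Submodule F (Fin n → F)) = Nat.card V :=
    (Nat.card_congr (Equiv.Set.image f.1 (V : Set (Fin n → F)) f.1.injective)).symm
  rw [Module.natCard_eq_pow_finrank (K := F) (V := V),
    Module.natCard_eq_pow_finrank (K := F) (V := (f • V : Submodule F (Fin n → F)))] at h
  exact Nat.pow_right_injective (a := Nat.card F) Finite.one_lt_card h

instance [Fintype F] (k : ℕ) :
    MulAction (semiMonomial F n) {V : Submodule F (Fin n → F) // Module.finrank F V = k} where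
  smul f V := ⟨f • V.1, by rw [semiMonomial.finrank_smul, V.2]⟩
  one_smul V := Subtype.ext (one_smul _ V.1)
  mul_smul f g V := Subtype.ext (mul_smul f g V.1)

theorem exists_eq_of_mem_monomialGroup {M : GL (Fin n) F} (hM : M ∈ MonomialGroup F n) :
    ∃ (π : Equiv.Perm (Fin n)) (d : Fin n → Fˣ), ∀ x,
      (M : Matrix (Fin n) (Fin n) F) *ᵥ x = monomialHom (RingEquiv.refl F) π d x := by
  induction hM using Subgroup.closure_induction with
  | mem M hM =>
    rcases hM with ⟨π, hπ⟩ | ⟨d, hd⟩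
    · refine ⟨π, 1, fun x => ?_⟩
      rw [hπ, Matrix.permMatrix_mulVec]
      ext i
      simp [monomialHom_apply]
    · have hu : IsUnit (Matrix.diagonal d) := hd ▸ M.isUnit
      rw [Matrix.isUnit_diagonal, Pi.isUnit_iff] at hu
      refine ⟨1, fun i => (hu i).unit, fun x => ?_⟩
      rw [hd]
      ext i
      simp [monomialHom_apply, Matrix.mulVec_diagonal]
  | one => exact ⟨1, 1, fun x => by ext i; simp [monomialHom_apply]⟩
  | mul M N _ _ hM hN =>
    obtain ⟨π, d, hM⟩ := hM
    obtain ⟨ρ, e, hN⟩ := hN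
    refine ⟨ρ * π, fun i => d i * e (π i), fun x => ?_⟩
    ext i
    rw [Units.val_mul, ← Matrix.mulVec_mulVec, hN, hM]
    simp [monomialHom_apply, mul_assoc]
  | inv M _ hM =>
    obtain ⟨π, d, hM⟩ := hM
    refine ⟨π⁻¹, fun i => (d (π⁻¹ i))⁻¹, fun x => ?_⟩
    have h : x = (M : Matrix (Fin n) (Fin n) F) *ᵥ
        monomialHom (RingEquiv.refl F) π⁻¹ (fun i => (d (π⁻¹ i))⁻¹) x := by
      rw [hM]
      ext i
      simp [monomialHom_apply]
    conv_lhs => rw [h]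
    rw [Matrix.mulVec_mulVec, ← Units.val_mul, inv_mul_cancel, Units.val_one, Matrix.one_mulVec]

theorem exists_mem_monomialGroup (π : Equiv.Perm (Fin n)) (d : Fin n → Fˣ) :
    ∃ M ∈ MonomialGroup F n, ∀ x,
      (M : Matrix (Fin n) (Fin n) F) *ᵥ x = monomialHom (RingEquiv.refl F) π d x := by
  have hd : IsUnit (Matrix.diagonal fun i => (d i : F)) := by
    rw [Matrix.isUnit_diagonal, Pi.isUnit_iff]
    exact fun i => (d i).isUnit
  have hπ : IsUnit (π.permMatrix F) := by
    rw [Matrix.isUnit_iff_isUnit_det, Matrix.det_permutation]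
    exact ((Units.isUnit _).map (Int.castRingHom F))
  refine ⟨hd.unit * hπ.unit, mul_mem (Subgroup.subset_closure (Or.inr ⟨_, rfl⟩))
    (Subgroup.subset_closure (Or.inl ⟨π, rfl⟩)), fun x => ?_⟩
  rw [Units.val_mul, ← Matrix.mulVec_mulVec]
  ext i
  simp [monomialHom_apply, Matrix.mulVec_diagonal, Matrix.permMatrix_mulVec]

theorem semiRel_iff {V W : Submodule F (Fin n → F)} :
    semiRel F n V W ↔ ∃ f : semiMonomial F n, f • V = W := by
  constructor
  · rintro ⟨σ, M, hM, h⟩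
    obtain ⟨π, d, hM⟩ := exists_eq_of_mem_monomialGroup hM
    let f : Equiv.Perm (Fin n → F) :=
      { toFun := monomialHom σ π d
        invFun := monomialHom σ.symm π⁻¹ fun i => Units.map (σ.symm : F →* F) (d (π⁻¹ i))⁻¹
        left_inv := fun x => by ext i; simp [monomialHom_apply]
        right_inv := fun x => by ext i; simp [monomialHom_apply] }
    refine ⟨⟨f, σ, π, d, fun x => rfl⟩, SetLike.coe_injective ?_⟩
    rw [h, semiMonomial.coe_smul]
    refine Set.image_congr fun x _ => ?_
    rw [hM]
    rfl
  · rintro ⟨⟨f, σ, π, d, hf⟩, rfl⟩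
    obtain ⟨M, hM, h⟩ := exists_mem_monomialGroup (F := F) π d
    refine ⟨σ, M, hM, ?_⟩
    rw [semiMonomial.coe_smul]
    refine Set.image_congr fun x _ => ?_
    rw [h, hf]
    rfl

theorem numClassesSemi_eq :
    numClassesSemi F n = Nat.card (Quotient (MulAction.orbitRel (semiMonomial F n)
      (Submodule F (Fin n → F)))) := by
  refine Nat.card_congr (Quot.congrRight fun V W => ?_)
  rw [semiRel_iff, Setoid.comm', MulAction.orbitRel_apply, MulAction.mem_orbit_iff]

theorem numClassesDimSemi_eq [Fintype F] (k : ℕ) :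
    numClassesDimSemi F n k = Nat.card (Quotient (MulAction.orbitRel (semiMonomial F n)
      {V : Submodule F (Fin n → F) // Module.finrank F V = k})) := by
  refine Nat.card_congr (Quot.congrRight fun V W => ?_)
  rw [semiRel_iff, Setoid.comm', MulAction.orbitRel_apply, MulAction.mem_orbit_iff]
  exact exists_congr fun f => (Subtype.ext_iff (a1 := f • V) (a2 := W)).symm

open Classical in
theorem exists_orbit_count [Fintype F] [Fintype (F ≃+* F)] (n : ℕ) :
    ∃ (N z D : ℕ) (Dk : ℕ → ℕ), 0 < N ∧ 0 < z ∧ (∀ k, Dk k ≤ D) ∧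
      numClassesSemi F n * N = z * Nat.card (Submodule F (Fin n → F)) + D ∧
      (∀ k, numClassesDimSemi F n k * N =
        z * Nat.card {V : Submodule F (Fin n → F) // Module.finrank F V = k} + Dk k) ∧
      D ≤ ∑ t : (F ≃+* F) × Equiv.Perm (Fin n) × (Fin n → Fˣ) with
          ¬ ∃ c : F, ∀ x, monomialHom t.1 t.2.1 t.2.2 x = c • x,
        invariantCount (monomialHom t.1 t.2.1 t.2.2) := by
  have : Finite (Equiv.Perm (Fin n → F)) := Finite.of_injective _ (DFunLike.coe_injective)
  have : Fintype (semiMonomial F n) := Fintype.ofFinite _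
  have : Finite (Submodule F (Fin n → F)) := Finite.of_injective _ SetLike.coe_injective
  let Z : Finset (semiMonomial F n) := {f | ∃ c : F, ∀ x, f.1 x = c • x}
  have hZ : ∀ f ∈ Z, ∀ V : Submodule F (Fin n → F), f • V = V := by
    intro f hf V
    obtain ⟨c, hc⟩ := (Finset.mem_filter.1 hf).2
    refine Submodule.eq_of_le_of_finrank_eq ?_ (semiMonomial.finrank_smul f V)
    rintro _ ⟨x, hx, rfl⟩
    rw [hc]
    exact V.smul_mem c hx
  refine ⟨Nat.card (semiMonomial F n), Z.card,
    ∑ f ∈ Zᶜ, Nat.card (MulAction.fixedBy (Submodule F (Fin n → F)) f),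
    fun k => ∑ f ∈ Zᶜ, Nat.card (MulAction.fixedBy
      {V : Submodule F (Fin n → F) // Module.finrank F V = k} f), Nat.card_pos, ?_, ?_, ?_, ?_, ?_⟩
  · exact Finset.card_pos.2 ⟨1, Finset.mem_filter.2 ⟨Finset.mem_univ _, 1, fun x => by simp⟩⟩
  · intro k
    refine Finset.sum_le_sum fun f _ => ?_
    exact Nat.card_le_card_of_injective
      (fun V => (⟨V.1.1, congrArg Subtype.val V.2⟩ :
        MulAction.fixedBy (Submodule F (Fin n → F)) f))
      fun V W h => Subtype.ext (Subtype.ext (Subtype.mk.inj h))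
  · rw [numClassesSemi_eq]
    exact natCard_orbits_mul_natCard_group Z hZ
  · intro k
    rw [numClassesDimSemi_eq]
    exact natCard_orbits_mul_natCard_group Z fun f hf V => Subtype.ext (hZ f hf V.1)
  · have hs : ∀ f : semiMonomial F n, ∃ t : (F ≃+* F) × Equiv.Perm (Fin n) × (Fin n → Fˣ),
        ∀ x, f.1 x = monomialHom t.1 t.2.1 t.2.2 x := by
      rintro ⟨f, σ, π, d, hf⟩
      exact ⟨(σ, π, d), hf⟩
    choose s hs using hs
    have hinj : Function.Injective s := by
      intro f g h
      apply Subtype.ext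
      ext x : 1
      rw [hs, hs, h]
    calc ∑ f ∈ Zᶜ, Nat.card (MulAction.fixedBy (Submodule F (Fin n → F)) f)
        ≤ ∑ f ∈ Zᶜ, invariantCount (monomialHom (s f).1 (s f).2.1 (s f).2.2) := by
          refine Finset.sum_le_sum fun f _ => Nat.card_le_card_of_injective
            (fun V => ⟨V.1, fun x hx => ?_⟩)
            fun V W h => Subtype.ext (Subtype.mk.inj h)
          have h : f • V.1 = V.1 := V.2
          rw [← hs, ← SetLike.mem_coe, ← h]
          exact ⟨x, hx, rfl⟩
      _ ≤ _ := by
          refine sum_comp_le_sum_of_injective (f := fun t => invariantCount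
            (monomialHom (F := F) t.1 t.2.1 t.2.2)) hinj fun f hf => ?_
          refine Finset.mem_filter.2 ⟨Finset.mem_univ _, ?_⟩
          rintro ⟨c, hc⟩
          refine Finset.mem_compl.1 hf (Finset.mem_filter.2 ⟨Finset.mem_univ _, c, fun x => ?_⟩)
          rw [hs, hc]

end SemiMonomial

theorem exists_independent_subset {n : ℕ} (π : Equiv.Perm (Fin n)) (s : Finset (Fin n)) :
    ∃ J ⊆ s, (∀ j ∈ J, π j = j ∨ π j ∉ J) ∧ s.card ≤ 3 * J.card := by
  obtain ⟨J, hJ, hmax⟩ := Finset.exists_max_image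
    (s.powerset.filter fun J => ∀ j ∈ J, π j = j ∨ π j ∉ J) Finset.card
    ⟨∅, by simp⟩
  rw [Finset.mem_filter, Finset.mem_powerset] at hJ
  refine ⟨J, hJ.1, hJ.2, ?_⟩
  have hsub : s ⊆ J ∪ (J.map π.toEmbedding ∪ J.map π⁻¹.toEmbedding) := by
    intro i hi
    by_contra hcon
    simp only [Finset.mem_union, Finset.mem_map_equiv, not_or] at hcon
    obtain ⟨h1, h2, h3⟩ := hcon
    have h2 : π⁻¹ i ∉ J := h2
    have h3 : π i ∉ J := h3
    have h4 := hmax (insert i J) ?_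
    · rw [Finset.card_insert_of_notMem h1] at h4
      omega
    · rw [Finset.mem_filter, Finset.mem_powerset]
      refine ⟨Finset.insert_subset hi hJ.1, fun j hj => ?_⟩
      rw [Finset.mem_insert, not_or]
      rcases Finset.mem_insert.1 hj with rfl | hj
      · by_cases h : π j = j
        · exact Or.inl h
        · exact Or.inr ⟨h, h3⟩
      · rcases hJ.2 j hj with h | h
        · exact Or.inl h
        · refine Or.inr ⟨fun hij => h2 ?_, h⟩
          rwa [← hij, Equiv.Perm.inv_def, Equiv.symm_apply_apply]
  have h1 := Finset.card_le_card hsub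
  have h2 := Finset.card_union_le J (J.map π.toEmbedding ∪ J.map π⁻¹.toEmbedding)
  have h3 := Finset.card_union_le (J.map π.toEmbedding) (J.map π⁻¹.toEmbedding)
  rw [Finset.card_map, Finset.card_map] at h3
  omega

section InvariantBound

variable {F : Type} [Field F] {n : ℕ}

theorem rpow_le_of_mul_pow_le {q : ℝ} (hq : 1 < q) {Y C x : ℝ} {a b : ℕ}
    (h : Y * q ^ a ≤ C * q ^ b) (hC : 0 ≤ C) (hx : (b : ℝ) - a ≤ x) : Y ≤ C * q ^ x := by
  have hq0 : 0 < q := by linarith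
  have h1 : Y ≤ C * q ^ ((b : ℝ) - a) := by
    rw [Real.rpow_sub hq0, Real.rpow_natCast, Real.rpow_natCast, ← mul_div_assoc,
      le_div_iff₀ (by positivity)]
    exact h
  exact h1.trans (mul_le_mul_of_nonneg_left (Real.rpow_le_rpow_of_exponent_le hq.le hx) hC)

theorem invariantCount_le [Fintype F] (g : (Fin n → F) →+ (Fin n → F)) {m : ℕ}
    (hm : ∀ c : F, Nat.card {x : Fin n → F // g x = c • x} * Fintype.card F ^ m ≤
      Fintype.card F ^ n) (hm1 : 1 ≤ m) (hn : 32 ≤ n) :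
    (invariantCount g : ℝ) ≤ (n + 1) * (16 * (Fintype.card F + 1) * Fintype.card F *
      (Fintype.card F : ℝ) ^ ((n : ℝ) ^ 2 / 4 - m * n / 128)) := by
  classical
  have hq : 2 ≤ Fintype.card F := Fintype.one_lt_card
  have hq1 : (1 : ℝ) < Fintype.card F := by exact_mod_cast hq
  have hmn : m ≤ n := by
    have h0 : 1 ≤ Nat.card {x : Fin n → F // g x = (0 : F) • x} :=
      Nat.card_pos_iff.2 ⟨⟨0, by simp⟩, inferInstance⟩
    have h1 := (Nat.le_mul_of_pos_left (Fintype.card F ^ m) h0).trans (hm 0)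
    exact (Nat.pow_le_pow_iff_right hq).1 h1
  have hmnR : (m : ℝ) ≤ n := by exact_mod_cast hmn
  have hnR : (32 : ℝ) ≤ n := by exact_mod_cast hn
  have hfin : Module.finrank F (Fin n → F) = n := by simp
  have hcard : Fintype.card (Fin n → F) = Fintype.card F ^ n := by simp
  have hmn2 : (m : ℝ) * n ≤ n * n := mul_le_mul_of_nonneg_right hmnR (by positivity)
  have : Fintype (Submodule F (Fin n → F)) := Fintype.ofFinite _
  rw [invariantCount, natCard_submodule_eq_sum, Nat.cast_sum]
  refine (Finset.sum_le_card_nsmul _ _ _ fun k hk => ?_).trans_eq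
    (by rw [Finset.card_range, nsmul_eq_mul]; push_cast; rfl)
  rw [Nat.card_eq_fintype_card, Fintype.card_subtype]
  set Y : Finset (Submodule F (Fin n → F)) :=
    {V | Module.finrank F V = k ∧ ∀ x ∈ V, g x ∈ V} with hYdef
  have hY : ∀ V ∈ Y, Module.finrank F V = k ∧ ∀ x ∈ V, g x ∈ V :=
    fun V hV => (Finset.mem_filter.1 hV).2
  have hk' : (k : ℝ) ≤ n := by
    have := Finset.mem_range.1 hk
    exact_mod_cast Nat.lt_succ_iff.1 this
  by_cases hmid : n ≤ 4 * k ∧ 4 * k ≤ 3 * n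
  · have h := card_invariant_middle_mul_le g Y (k := k) (m := m) (e := m * n / 128) hY
      (by rw [hcard]; exact hm) hm1 (by rw [hfin]; exact hn) (by rw [hfin]; exact hmid.1)
      (by rw [hfin]; exact hmid.2) (by rw [hfin]; omega)
    rw [hfin] at h
    have h' : (Y.card : ℝ) * (Fintype.card F : ℝ) ^ (k * k + m * n / 128) ≤
        (16 * (Fintype.card F + 1)) * (Fintype.card F : ℝ) ^ (n * k) := by exact_mod_cast h
    have he : (m : ℝ) * n ≤ 128 * (m * n / 128 : ℕ) + 128 := by
      have : m * n ≤ 128 * (m * n / 128) + 128 := by omega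
      exact_mod_cast this
    have h2 := rpow_le_of_mul_pow_le (x := 1 + ((n : ℝ) ^ 2 / 4 - m * n / 128)) hq1 h'
      (by positivity) (by push_cast; nlinarith [sq_nonneg ((n : ℝ) - 2 * k)])
    rw [Real.rpow_add (by linarith), Real.rpow_one] at h2
    linarith
  · have h := card_mul_le_of_finrank_eq Y (k := k) fun V hV => (hY V hV).1
    rw [hcard, ← pow_mul] at h
    have h' : (Y.card : ℝ) * (Fintype.card F : ℝ) ^ (k * k) ≤
        16 * (Fintype.card F : ℝ) ^ (n * k) := by exact_mod_cast h
    have h2 := rpow_le_of_mul_pow_le (x := (n : ℝ) ^ 2 / 4 - m * n / 128) hq1 h'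
      (by positivity) (by
        push_cast
        rw [not_and_or, not_le, not_le] at hmid
        have : 0 ≤ ((n : ℝ) - 4 * k) * (3 * n - 4 * k) := by
          rcases hmid with h | h
          · have : (4 : ℝ) * k ≤ n := by exact_mod_cast h.le
            apply mul_nonneg <;> linarith
          · have : (3 : ℝ) * n ≤ 4 * k := by exact_mod_cast h.le
            apply mul_nonneg_of_nonpos_of_nonpos <;> linarith
        nlinarith)
    refine h2.trans (mul_le_mul_of_nonneg_right ?_ (by positivity))
    nlinarith

theorem eq_zero_of_monomialHom_eq_zero {σ : F ≃+* F} {π : Equiv.Perm (Fin n)} {d : Fin n → Fˣ}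
    {x : Fin n → F} (h : monomialHom σ π d x = 0) : x = 0 := by
  ext i
  have := congrFun h (π⁻¹ i)
  simpa [monomialHom_apply] using this

theorem natCard_eigen_zero (σ : F ≃+* F) (π : Equiv.Perm (Fin n)) (d : Fin n → Fˣ) :
    Nat.card {x : Fin n → F // monomialHom σ π d x = (0 : F) • x} = 1 := by
  rw [Nat.card_eq_one_iff_unique]
  refine ⟨⟨fun x y => Subtype.ext ?_⟩, ⟨0, by simp⟩⟩
  have hx := x.2
  have hy := y.2
  rw [zero_smul] at hx hy
  rw [eq_zero_of_monomialHom_eq_zero hx, eq_zero_of_monomialHom_eq_zero hy]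

theorem natCard_eigen_mul_le_of_ne_refl [Fintype F] {σ : F ≃+* F} (hσ : σ ≠ RingEquiv.refl F)
    (π : Equiv.Perm (Fin n)) (d : Fin n → Fˣ) (c : F) :
    Nat.card {x : Fin n → F // monomialHom σ π d x = c • x} * Fintype.card F ^ (n / 2) ≤
      Fintype.card F ^ n := by
  obtain ⟨α, hα⟩ : ∃ α, σ α ≠ α := by
    by_contra! h
    exact hσ (RingEquiv.ext h)
  have hsq : Nat.card {x : Fin n → F // monomialHom σ π d x = c • x} ^ 2 ≤
      Fintype.card F ^ n := by
    have hE : Nat.card (Fin n → F) = Fintype.card F ^ n := by simp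
    rw [sq, ← Nat.card_prod, ← hE]
    refine Nat.card_le_card_of_injective
      (fun p => (p.1 : Fin n → F) + α • (p.2 : Fin n → F)) ?_
    rintro ⟨⟨x, hx⟩, ⟨y, hy⟩⟩ ⟨⟨x', hx'⟩, ⟨y', hy'⟩⟩ h
    have h : x + α • y = x' + α • y' := h
    have hv : y' - y = 0 := by
      have hv1 : monomialHom σ π d (y' - y) = c • (y' - y) := by
        rw [map_sub, hy, hy', smul_sub]
      have hu1 : monomialHom σ π d (x - x') = c • (x - x') := by
        rw [map_sub, hx, hx', smul_sub]
      have hu : x - x' = α • (y' - y) := by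
        rw [smul_sub, sub_eq_sub_iff_add_eq_add, h, add_comm]
      have hα2 : monomialHom σ π d (α • (y' - y)) = σ α • monomialHom σ π d (y' - y) := by
        ext i
        simp only [monomialHom_apply, Pi.smul_apply, smul_eq_mul, map_mul]
        ring
      rw [hu, hα2, hv1, smul_comm, ← sub_eq_zero, ← smul_sub, ← sub_smul] at hu1
      rcases smul_eq_zero.1 hu1 with hc | hu1
      · rw [hc, zero_smul] at hv1
        exact eq_zero_of_monomialHom_eq_zero hv1
      · exact (smul_eq_zero.1 hu1).resolve_left (sub_ne_zero.2 hα)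
    have hy2 : y = y' := (sub_eq_zero.1 hv).symm
    subst hy2
    have hx2 : x = x' := add_right_cancel h
    subst hx2
    rfl
  refine (Nat.pow_le_pow_iff_left two_ne_zero).1 ?_
  rw [mul_pow, sq (Fintype.card F ^ n), ← pow_mul]
  exact Nat.mul_le_mul hsq (Nat.pow_le_pow_right Fintype.card_pos (by omega))

/-- The coordinates on which a monomial map differs from the scalar `c`. -/
def movedCoords [DecidableEq F] (π : Equiv.Perm (Fin n)) (d : Fin n → Fˣ) (c : Fˣ) :
    Finset (Fin n) := {i | π i ≠ i ∨ d i ≠ c}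

theorem natCard_eigen_mul_le [Fintype F] [DecidableEq F] (π : Equiv.Perm (Fin n))
    (d : Fin n → Fˣ) (c : Fˣ) {m : ℕ} (hm : m ≤ ((movedCoords π d c).card + 2) / 3) :
    Nat.card {x : Fin n → F // monomialHom (RingEquiv.refl F) π d x = (c : F) • x} *
      Fintype.card F ^ m ≤ Fintype.card F ^ n := by
  obtain ⟨J, hJs, hJ, hcard⟩ := exists_independent_subset π (movedCoords π d c)
  have h1 : Nat.card {x : Fin n → F // monomialHom (RingEquiv.refl F) π d x = (c : F) • x} ≤
      Fintype.card F ^ (n - J.card) := by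
    have h2 : Nat.card ((Jᶜ : Finset (Fin n)) → F) = Fintype.card F ^ (n - J.card) := by
      rw [Nat.card_eq_fintype_card, Fintype.card_fun, Fintype.card_coe, Finset.card_compl,
        Fintype.card_fin]
    rw [← h2]
    refine Nat.card_le_card_of_injective (fun x i => x.1 i) ?_
    rintro ⟨x, hx⟩ ⟨y, hy⟩ h
    have hout : ∀ i, i ∉ J → x i = y i := fun i hi =>
      congrFun h ⟨i, Finset.mem_compl.2 hi⟩
    apply Subtype.ext
    ext i
    change x i = y i
    by_cases hi : i ∈ J
    · have hxi : d i * x (π i) = c * x i := congrFun hx i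
      have hyi : d i * y (π i) = c * y i := congrFun hy i
      by_cases hfix : π i = i
      · have hd : d i ≠ c :=
          ((Finset.mem_filter.1 (hJs hi)).2).resolve_left (not_not.2 hfix)
        rw [hfix] at hxi hyi
        have hd' : (d i : F) - c ≠ 0 := sub_ne_zero.2 fun h => hd (Units.ext h)
        have hx0 : ((d i : F) - c) * x i = 0 := by rw [sub_mul, hxi, sub_self]
        have hy0 : ((d i : F) - c) * y i = 0 := by rw [sub_mul, hyi, sub_self]
        rw [(mul_eq_zero.1 hx0).resolve_left hd', (mul_eq_zero.1 hy0).resolve_left hd']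
      · rw [hout (π i) ((hJ i hi).resolve_left hfix), hyi] at hxi
        exact (mul_left_cancel₀ c.ne_zero hxi).symm
    · exact hout i hi
  have hJn : J.card ≤ n := by simpa using Finset.card_le_univ J
  calc _ ≤ Fintype.card F ^ (n - J.card) * Fintype.card F ^ J.card :=
        Nat.mul_le_mul h1 (Nat.pow_le_pow_right Fintype.card_pos (by omega))
    _ = _ := by rw [← pow_add]; congr 1; omega

end InvariantBound

section SumBound

variable {F : Type} [Field F] [Fintype F] {n : ℕ}

open Classical in
theorem sum_pow_card_movedCoords_le (c : Fˣ) {w : ℝ} (hw : 0 ≤ w) :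
    ∑ p : Equiv.Perm (Fin n) × (Fin n → Fˣ), w ^ (movedCoords p.1 p.2 c).card ≤
      (1 + n * Fintype.card F * w) ^ n := by
  let v : Fin n → Fin n × Fˣ → ℝ := fun i a => if a = (i, c) then 1 else w
  have hv : ∀ i a, 0 ≤ v i a := fun i a => by
    dsimp only [v]
    split_ifs <;> positivity
  let s : Equiv.Perm (Fin n) × (Fin n → Fˣ) → (Fin n → Fin n × Fˣ) := fun p i => (p.1 i, p.2 i)
  have hs : Function.Injective s := by
    intro p p' h
    refine Prod.ext (Equiv.ext fun i => ?_) (funext fun i => ?_)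
    · exact congrArg Prod.fst (congrFun h i)
    · exact congrArg Prod.snd (congrFun h i)
  calc ∑ p : Equiv.Perm (Fin n) × (Fin n → Fˣ), w ^ (movedCoords p.1 p.2 c).card
      = ∑ p : Equiv.Perm (Fin n) × (Fin n → Fˣ), ∏ i, v i (s p i) := by
        refine Finset.sum_congr rfl fun p _ => ?_
        rw [movedCoords, ← Finset.prod_const, Finset.prod_filter]
        refine Finset.prod_congr rfl fun i _ => ?_
        simp only [v, s, Prod.mk.injEq]
        by_cases h : p.1 i = i ∧ p.2 i = c
        · rw [if_pos h, if_neg (by tauto)]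
        · rw [if_neg h, if_pos (by tauto)]
    _ = ∑ φ ∈ Finset.univ.map ⟨s, hs⟩, ∏ i, v i (φ i) := by rw [Finset.sum_map]; rfl
    _ ≤ ∑ φ : Fin n → Fin n × Fˣ, ∏ i, v i (φ i) :=
        Finset.sum_le_sum_of_subset_of_nonneg (Finset.subset_univ _)
          fun φ _ _ => Finset.prod_nonneg fun i _ => hv i _
    _ = ∏ i, ∑ a, v i a := by rw [Finset.prod_univ_sum, Fintype.piFinset_univ]
    _ ≤ ∏ _i : Fin n, (1 + n * Fintype.card F * w) := by
        refine Finset.prod_le_prod (fun i _ => Finset.sum_nonneg fun a _ => hv i a) fun i _ => ?_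
        calc ∑ a, v i a ≤ ∑ a : Fin n × Fˣ, ((if a = (i, c) then 1 else 0) + w) := by
              refine Finset.sum_le_sum fun a _ => ?_
              dsimp only [v]
              split_ifs <;> linarith
          _ = 1 + n * Fintype.card Fˣ * w := by
              rw [Finset.sum_add_distrib, Finset.sum_ite_eq' Finset.univ,
                if_pos (Finset.mem_univ _), Finset.sum_const, Finset.card_univ, Fintype.card_prod,
                Fintype.card_fin, nsmul_eq_mul]
              push_cast
              rfl
          _ ≤ 1 + n * Fintype.card F * w := by
              have : (Fintype.card Fˣ : ℝ) ≤ Fintype.card F := by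
                exact_mod_cast Fintype.card_le_of_injective _ Units.val_injective
              gcongr
    _ = (1 + n * Fintype.card F * w) ^ n := by
        rw [Finset.prod_const, Finset.card_univ, Fintype.card_fin]

theorem rpow_sub_eq_mul_pow {q : ℝ} (hq : 0 < q) (x : ℝ) (m n : ℕ) :
    q ^ (x - m * n / 128) = q ^ x * (q ^ (-1 / 1536 : ℝ)) ^ (12 * m * n) := by
  rw [← Real.rpow_natCast, ← Real.rpow_mul hq.le, ← Real.rpow_add hq]
  congr 1
  push_cast
  ring

open Classical in
theorem invariantCount_monomialHom_le (hn : 32 ≤ n) (σ : F ≃+* F) (π : Equiv.Perm (Fin n))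
    (d : Fin n → Fˣ) (h : ¬ ∃ c : F, ∀ x, monomialHom σ π d x = c • x) {q s w : ℝ}
    (hq : q = Fintype.card F) (hs : s = q ^ (-1 / 1536 : ℝ)) (hw : w = s ^ (2 * n)) :
    (invariantCount (monomialHom σ π d) : ℝ) ≤
      (n + 1) * (16 * (q + 1) * q * q ^ ((n : ℝ) ^ 2 / 4)) *
        (s ^ (12 * (n / 2) * n) +
          if σ = RingEquiv.refl F then ∑ c : Fˣ, w * w ^ (movedCoords π d c).card else 0) := by
  have hq2 : 2 ≤ Fintype.card F := Fintype.one_lt_card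
  have hq1 : 1 < q := by rw [hq]; exact_mod_cast hq2
  have hq0 : 0 < q := by linarith
  have hs0 : 0 < s := by rw [hs]; positivity
  have hs1 : s ≤ 1 := by rw [hs]; exact Real.rpow_le_one_of_one_le_of_nonpos hq1.le (by norm_num)
  have hw0 : 0 < w := by rw [hw]; positivity
  have key : ∀ {m : ℕ} {T : ℝ}, (∀ c : F, Nat.card {x : Fin n → F // monomialHom σ π d x = c • x} *
      Fintype.card F ^ m ≤ Fintype.card F ^ n) → 1 ≤ m → s ^ (12 * m * n) ≤ T →
      (invariantCount (monomialHom σ π d) : ℝ) ≤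
        (n + 1) * (16 * (q + 1) * q * q ^ ((n : ℝ) ^ 2 / 4)) * T := by
    intro m T hm hm1 hT
    have h1 := invariantCount_le _ hm hm1 hn
    rw [← hq, rpow_sub_eq_mul_pow hq0, ← hs, ← mul_assoc (16 * (q + 1) * q), ← mul_assoc] at h1
    exact h1.trans (mul_le_mul_of_nonneg_left hT (by positivity))
  by_cases hσ : σ = RingEquiv.refl F
  · rw [if_pos hσ]
    subst hσ
    obtain ⟨c₀, -, hc₀⟩ := Finset.exists_min_image Finset.univ
      (fun c : Fˣ => (movedCoords π d c).card) ⟨1, Finset.mem_univ _⟩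
    have hb : 1 ≤ (movedCoords π d c₀).card := by
      by_contra! hb
      have hb : movedCoords π d c₀ = ∅ := Finset.card_eq_zero.1 (by omega)
      refine h ⟨c₀, fun x => funext fun i => ?_⟩
      have hi : i ∉ movedCoords π d c₀ := by rw [hb]; exact Finset.notMem_empty i
      rw [movedCoords, Finset.mem_filter, not_and, not_or, not_not, not_not] at hi
      obtain ⟨h1, h2⟩ := hi (Finset.mem_univ i)
      simp [monomialHom_apply, h1, h2]
    have hbn : (movedCoords π d c₀).card ≤ n := by
      simpa using Finset.card_le_univ (movedCoords π d c₀)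
    refine key (m := ((movedCoords π d c₀).card + 2) / 3) (fun c => ?_) (by omega) ?_
    · by_cases hc : c = 0
      · rw [hc, natCard_eigen_zero, one_mul]
        exact Nat.pow_le_pow_right Fintype.card_pos (by omega)
      · have hle := hc₀ (Units.mk0 c hc) (Finset.mem_univ _)
        exact natCard_eigen_mul_le π d (Units.mk0 c hc) (by omega)
    · have h1 : s ^ (12 * (((movedCoords π d c₀).card + 2) / 3) * n) ≤
          w * w ^ (movedCoords π d c₀).card := by
        rw [← pow_succ', hw, ← pow_mul]
        refine pow_le_pow_of_le_one hs0.le hs1 ?_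
        rw [mul_right_comm]
        refine Nat.mul_le_mul_right n ?_
        omega
      have h2 := Finset.single_le_sum (f := fun c : Fˣ => w * w ^ (movedCoords π d c).card)
        (fun c _ => by positivity) (Finset.mem_univ c₀)
      have h3 : 0 ≤ s ^ (12 * (n / 2) * n) := by positivity
      linarith
  · rw [if_neg hσ, add_zero]
    exact key (natCard_eigen_mul_le_of_ne_refl hσ π d) (by omega) le_rfl

open Classical in
theorem sum_invariantCount_le (hn : 32 ≤ n) {q s w : ℝ} [Fintype (F ≃+* F)]
    (hq : q = Fintype.card F) (hs : s = q ^ (-1 / 1536 : ℝ)) (hw : w = s ^ (2 * n)) :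
    ((∑ t : (F ≃+* F) × Equiv.Perm (Fin n) × (Fin n → Fˣ) with
          ¬ ∃ c : F, ∀ x, monomialHom t.1 t.2.1 t.2.2 x = c • x,
        invariantCount (monomialHom t.1 t.2.1 t.2.2) : ℕ) : ℝ) ≤
      (n + 1) * (16 * (q + 1) * q * q ^ ((n : ℝ) ^ 2 / 4)) *
        (Fintype.card (F ≃+* F) * (n ^ n * q ^ n * s ^ (12 * (n / 2) * n)) +
          q * (w * (1 + n * q * w) ^ n)) := by
  have hq0 : 0 < q := by rw [hq]; exact_mod_cast Fintype.card_pos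
  have hs0 : 0 < s := by rw [hs]; positivity
  have hw0 : 0 < w := by rw [hw]; positivity
  have hunits : (Fintype.card Fˣ : ℝ) ≤ q := by
    rw [hq]
    exact_mod_cast Fintype.card_le_of_injective _ Units.val_injective
  set K : ℝ := (n + 1) * (16 * (q + 1) * q * q ^ ((n : ℝ) ^ 2 / 4)) with hK
  have hK0 : 0 ≤ K := by positivity
  let T : (F ≃+* F) × Equiv.Perm (Fin n) × (Fin n → Fˣ) → ℝ := fun t =>
    s ^ (12 * (n / 2) * n) + if t.1 = RingEquiv.refl F then
      ∑ c : Fˣ, w * w ^ (movedCoords t.2.1 t.2.2 c).card else 0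
  have hT : ∀ t, 0 ≤ T t := fun t => by
    dsimp only [T]
    split_ifs <;> positivity
  rw [Nat.cast_sum]
  calc _ ≤ ∑ t : (F ≃+* F) × Equiv.Perm (Fin n) × (Fin n → Fˣ) with
          ¬ ∃ c : F, ∀ x, monomialHom t.1 t.2.1 t.2.2 x = c • x, K * T t :=
        Finset.sum_le_sum fun t ht =>
          invariantCount_monomialHom_le hn _ _ _ (Finset.mem_filter.1 ht).2 hq hs hw
    _ ≤ ∑ t, K * T t := Finset.sum_le_sum_of_subset_of_nonneg (Finset.subset_univ _)
        fun t _ _ => mul_nonneg hK0 (hT t)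
    _ = K * ∑ t, T t := by rw [Finset.mul_sum]
    _ ≤ _ := by
        refine mul_le_mul_of_nonneg_left ?_ hK0
        rw [Finset.sum_add_distrib]
        refine add_le_add ?_ ?_
        · rw [Finset.sum_const, Finset.card_univ, Fintype.card_prod, Fintype.card_prod,
            Fintype.card_perm, Fintype.card_fun, Fintype.card_fin, nsmul_eq_mul]
          push_cast
          rw [mul_assoc]
          have h1 : (n.factorial : ℝ) ≤ (n : ℝ) ^ n := by exact_mod_cast Nat.factorial_le_pow n
          gcongr
        · rw [Fintype.sum_prod_type, Finset.sum_eq_single (RingEquiv.refl F)]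
          · simp only [if_true]
            rw [Finset.sum_comm]
            refine (Finset.sum_le_card_nsmul _ _ (w * (1 + n * q * w) ^ n) fun c _ => ?_).trans ?_
            · rw [← Finset.mul_sum, hq]
              exact mul_le_mul_of_nonneg_left (sum_pow_card_movedCoords_le c hw0.le) hw0.le
            · rw [Finset.card_univ, nsmul_eq_mul]
              gcongr
          · intro σ _ hσ
            simp [hσ]
          · simp

end SumBound

section Asymptotics

theorem tendsto_errorTerm {s : ℝ} (hs0 : 0 < s) (hs1 : s < 1) (C a q : ℝ) :
    Tendsto (fun n : ℕ => ((n : ℝ) + 1) * C * (a * (1 / 2) ^ n + q * Real.exp 1 * s ^ n))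
      atTop (𝓝 0) := by
  have h : ∀ r : ℝ, |r| < 1 → Tendsto (fun n : ℕ => ((n : ℝ) + 1) * r ^ n) atTop (𝓝 0) := by
    intro r hr
    have h1 := (tendsto_pow_const_mul_const_pow_of_abs_lt_one 1 hr).add
      (tendsto_pow_const_mul_const_pow_of_abs_lt_one 0 hr)
    rw [add_zero] at h1
    exact h1.congr fun n => by ring
  have h1 := ((h (1 / 2) (by norm_num [abs_of_pos])).const_mul (C * a)).add
    ((h s (by rwa [abs_of_pos hs0])).const_mul (C * (q * Real.exp 1)))
  rw [mul_zero, mul_zero, add_zero] at h1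
  exact h1.congr fun n => by ring

theorem eventually_errorTerm_le {s : ℝ} (hs0 : 0 < s) (hs1 : s < 1) {C a q : ℝ} (hC : 0 ≤ C)
    (ha : 0 ≤ a) (hq : 0 ≤ q) :
    ∀ᶠ n : ℕ in atTop, ((n : ℝ) + 1) * C * (a * (n ^ n * q ^ n * s ^ (12 * (n / 2) * n)) +
        q * (s ^ (2 * n) * (1 + n * q * s ^ (2 * n)) ^ n)) ≤
      s ^ n * (((n : ℝ) + 1) * C * (a * (1 / 2) ^ n + q * Real.exp 1 * s ^ n)) := by
  have h1 := (tendsto_pow_const_mul_const_pow_of_abs_lt_one 1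
    (show |s| < 1 by rwa [abs_of_pos hs0])).const_mul q
  have h2 := (tendsto_pow_const_mul_const_pow_of_abs_lt_one 2
    (show |s ^ 2| < 1 by rw [abs_of_pos (by positivity)]; nlinarith)).const_mul q
  rw [mul_zero] at h1 h2
  filter_upwards [h1.eventually_lt_const (show (0 : ℝ) < 1 / 2 by norm_num),
    h2.eventually_lt_const one_pos, eventually_ge_atTop 2] with n h1 h2 hn
  rw [pow_one] at h1
  have e1 : (n : ℝ) ^ n * q ^ n * s ^ (12 * (n / 2) * n) ≤ s ^ n * (1 / 2) ^ n := by
    have h3 : s ^ (12 * (n / 2) * n) ≤ s ^ n * (s ^ n) ^ n := by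
      rw [← pow_mul, ← pow_add]
      refine pow_le_pow_of_le_one hs0.le hs1.le ?_
      have : (1 + n) * n ≤ 12 * (n / 2) * n := Nat.mul_le_mul_right n (by omega)
      linarith
    calc (n : ℝ) ^ n * q ^ n * s ^ (12 * (n / 2) * n)
        ≤ (n : ℝ) ^ n * q ^ n * (s ^ n * (s ^ n) ^ n) := by gcongr
      _ = s ^ n * (q * (n * s ^ n)) ^ n := by rw [mul_pow q, mul_pow (n : ℝ)]; ring
      _ ≤ s ^ n * (1 / 2) ^ n := by gcongr
  have e2 : (1 + n * q * s ^ (2 * n)) ^ n ≤ Real.exp 1 := by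
    calc (1 + n * q * s ^ (2 * n)) ^ n ≤ Real.exp (n * q * s ^ (2 * n)) ^ n := by
          have := Real.add_one_le_exp (n * q * s ^ (2 * n))
          gcongr
          linarith
      _ = Real.exp (q * (n ^ 2 * (s ^ 2) ^ n)) := by
          rw [← Real.exp_nat_mul, ← pow_mul]
          congr 1
          ring
      _ ≤ Real.exp 1 := Real.exp_le_exp.2 h2.le
  calc _ ≤ ((n : ℝ) + 1) * C * (a * (s ^ n * (1 / 2) ^ n) + q * (s ^ (2 * n) * Real.exp 1)) := by
        gcongr
    _ = _ := by rw [two_mul, pow_add]; ring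

theorem one_div_one_add_le_ratio_le {N z B S D Dk Nk Nt u : ℝ} (hN : 0 < N) (hz : 1 ≤ z)
    (hB : 0 < B) (hBS : B ≤ S) (hDk0 : 0 ≤ Dk) (hDk : Dk ≤ D) (hD : D ≤ B * u)
    (hNk : Nk * N = z * B + Dk) (hNt : Nt * N = z * S + D) :
    1 / (1 + u) ≤ Nk / Nt / (B / S) ∧ Nk / Nt / (B / S) ≤ 1 + u := by
  have hS : 0 < S := hB.trans_le hBS
  have hz0 : 0 < z := by linarith
  have hD0 : 0 ≤ D := hDk0.trans hDk
  have hu : 0 ≤ u := by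
    by_contra! h
    nlinarith
  have hratio : Nk / Nt / (B / S) = (z * B + Dk) * S / ((z * S + D) * B) := by
    have hNk' : Nk = (z * B + Dk) / N := by rw [← hNk]; field_simp
    have hNt' : Nt = (z * S + D) / N := by rw [← hNt]; field_simp
    have : 0 < z * S + D := by positivity
    rw [hNk', hNt']
    field_simp
  have hden : 0 < (z * S + D) * B := by positivity
  have hzB : B * u ≤ z * (B * u) := le_mul_of_one_le_left (by positivity) hz
  rw [hratio]
  constructor
  · rw [div_le_div_iff₀ (by linarith) hden]
    have h1 : D ≤ z * S * u := by
      have : z * (B * u) ≤ z * (S * u) := by gcongr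
      linarith
    have h2 : D * B ≤ z * S * u * B := mul_le_mul_of_nonneg_right h1 hB.le
    have h3 : 0 ≤ Dk * S * (1 + u) := by positivity
    linarith
  · rw [div_le_iff₀ hden]
    have h1 : Dk * S ≤ z * (B * u) * S := mul_le_mul_of_nonneg_right (by linarith) hS.le
    have h3 : 0 ≤ D * B * (1 + u) := by positivity
    linarith

end Asymptotics

theorem stmt5 (q p h : ℕ) (hp : p.Prime) (hh : 1 ≤ h) (hqph : q = p ^ h)
    (F : Type) [Field F] [Fintype F] (hq : Fintype.card F = q) :
    ∃ A > (0 : ℝ), ∃ ε > (0 : ℝ), ∀ k : ℕ → ℕ, (∀ n, k n ≤ n) → StarCond A ε k →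
      Tendsto (fun n : ℕ =>
          ((numClassesDimSemi F n (k n) : ℝ) / (numClassesSemi F n : ℝ)) /
          (qBinom q n (k n) / Sq q n))
        atTop (𝓝 1) := by
  classical
  have : Finite (F ≃+* F) := Finite.of_injective _ DFunLike.coe_injective
  have : Fintype (F ≃+* F) := Fintype.ofFinite _
  subst hq
  refine ⟨1, one_pos, 1 / 1536, by norm_num, fun k hk hstar => ?_⟩
  have hq2 : 2 ≤ Fintype.card F := Fintype.one_lt_card
  set Q : ℝ := (Fintype.card F : ℝ) with hQ
  have hQ1 : 1 < Q := by rw [hQ]; exact_mod_cast hq2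
  have hQ0 : 0 < Q := by linarith
  set s : ℝ := Q ^ (-1 / 1536 : ℝ) with hs
  have hs0 : 0 < s := by positivity
  have hs1 : s < 1 := Real.rpow_lt_one_of_one_lt_of_neg hQ1 (by norm_num)
  set u : ℕ → ℝ := fun n => ((n : ℝ) + 1) * (16 * (Q + 1) * Q) *
    (Fintype.card (F ≃+* F) * (1 / 2) ^ n + Q * Real.exp 1 * s ^ n) with hu
  have hu0 : Tendsto u atTop (𝓝 0) := tendsto_errorTerm hs0 hs1 _ _ _
  have hbounds : ∀ᶠ n : ℕ in atTop,
      1 / (1 + u n) ≤ (numClassesDimSemi F n (k n) : ℝ) / (numClassesSemi F n : ℝ) /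
          (qBinom (Fintype.card F) n (k n) / Sq (Fintype.card F) n) ∧
        (numClassesDimSemi F n (k n) : ℝ) / (numClassesSemi F n : ℝ) /
          (qBinom (Fintype.card F) n (k n) / Sq (Fintype.card F) n) ≤ 1 + u n := by
    filter_upwards [eventually_ge_atTop 32, hstar.eventually_le_atBot 0,
      eventually_errorTerm_le hs0 hs1 (C := 16 * (Q + 1) * Q)
        (a := Fintype.card (F ≃+* F)) (q := Q) (by positivity) (by positivity) hQ0.le]
      with n hn hstar herr
    obtain ⟨N, z, D, Dk, hN, hz, hDk, hNt, hNk, hD⟩ := exists_orbit_count (F := F) n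
    have hB1 : Q ^ ((n : ℝ) ^ 2 / 4) * s ^ n ≤ qBinom (Fintype.card F) n (k n) := by
      refine le_trans ?_ (pow_le_qBinom hq2 (hk n))
      rw [← hQ, hs, ← Real.rpow_natCast Q, ← Real.rpow_natCast (Q ^ (-1 / 1536 : ℝ)),
        ← Real.rpow_mul hQ0.le, ← Real.rpow_add hQ0]
      refine Real.rpow_le_rpow_of_exponent_le hQ1.le ?_
      rw [Nat.cast_mul, Nat.cast_sub (hk n)]
      have := Real.sqrt_nonneg (n : ℝ)
      linarith
    have hB0 : 0 < qBinom (Fintype.card F) n (k n) := lt_of_lt_of_le (by positivity) hB1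
    have hDu : (D : ℝ) ≤ qBinom (Fintype.card F) n (k n) * u n := by
      have h1 := sum_invariantCount_le (F := F) hn hQ hs rfl
      have hun : 0 ≤ u n := by positivity
      calc (D : ℝ) ≤ _ := (Nat.cast_le.2 hD).trans h1
        _ = Q ^ ((n : ℝ) ^ 2 / 4) * (((n : ℝ) + 1) * (16 * (Q + 1) * Q) *
            (Fintype.card (F ≃+* F) * (n ^ n * Q ^ n * s ^ (12 * (n / 2) * n)) +
              Q * (s ^ (2 * n) * (1 + n * Q * s ^ (2 * n)) ^ n))) := by ring
        _ ≤ Q ^ ((n : ℝ) ^ 2 / 4) * (s ^ n * u n) := by gcongr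
        _ = Q ^ ((n : ℝ) ^ 2 / 4) * s ^ n * u n := by ring
        _ ≤ _ := by gcongr
    have hBS : qBinom (Fintype.card F) n (k n) ≤ Sq (Fintype.card F) n := by
      refine Finset.single_le_sum (f := fun j => qBinom (Fintype.card F) n j) (fun j hj => ?_)
        (Finset.mem_range.2 (Nat.lt_succ_of_le (hk n)))
      exact le_trans (by positivity)
        (pow_le_qBinom hq2 (Nat.lt_succ_iff.1 (Finset.mem_range.1 hj)))
    refine one_div_one_add_le_ratio_le (N := N) (z := z) (D := D) (Dk := Dk (k n))
      (by exact_mod_cast hN) (by exact_mod_cast hz) hB0 hBS (by positivity)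
      (by exact_mod_cast hDk _) hDu ?_ ?_
    · rw [qBinom_eq_natCard (hk n)]
      exact_mod_cast hNk (k n)
    · rw [Sq_eq_natCard]
      exact_mod_cast hNt
  have h1 : Tendsto (fun n => 1 + u n) atTop (𝓝 1) := by simpa using hu0.const_add 1
  have h2 : Tendsto (fun n => 1 / (1 + u n)) atTop (𝓝 1) := by
    simpa using h1.inv₀ one_ne_zero
  exact tendsto_of_tendsto_of_tendsto_of_le_of_le' h2 h1 (hbounds.mono fun _ h => h.1)
    (hbounds.mono fun _ h => h.2)
end

section
/- Let q be a prime power. There exist real constants A > 0 and ε > 0 such that for every function k : ℕ → ℕ satisfying k(n) ≤ n for all n and lim_{n→∞} ( n²/4 − ε·n + A·√n − k(n)·(n − k(n)) ) = −∞ (condition (⋆)), the number N^S_{k(n),n} of permutation equivalence classes of k(n)-dimensional linear codes in F_q^n satisfies N^S_{k(n),n} ∼ q^{k(n)·(n − k(n))} / ( K_q · n! ) as n → ∞. -/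
open Filter Matrix
open scoped Topology

/-- Over a principal ideal domain, a finite module with `c` generators has at most `|M| ^ c`
submodules. -/
theorem card_submodule_le_pow {R M ι : Type*} [CommRing R] [IsDomain R] [IsPrincipalIdealRing R]
    [AddCommGroup M] [Module R M] [Finite M] [Fintype ι] (b : ι → M)
    (hb : Submodule.span R (Set.range b) = ⊤) :
    Nat.card (Submodule R M) ≤ Nat.card M ^ Fintype.card ι := by
  have hsurj : Function.Surjective
      (fun w : ι → M => Submodule.span R (Set.range w)) := by
    intro N
    let φ := Fintype.linearCombination R b
    have hφ : LinearMap.range φ = ⊤ := by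
      rw [Fintype.range_linearCombination, hb]
    obtain ⟨m, ⟨B⟩⟩ := Submodule.nonempty_basis_of_pid (Pi.basisFun R ι) (N.comap φ)
    have hm : m ≤ Fintype.card ι := by
      have h1 := Module.finrank_eq_card_basis B
      have h2 := Submodule.finrank_le (N.comap φ)
      rw [Module.finrank_fintype_fun_eq_card] at h2
      simp only [Fintype.card_fin] at h1
      omega
    obtain ⟨e⟩ : Nonempty (Fin m ↪ ι) :=
      Function.Embedding.nonempty_of_card_le (by simpa using hm)
    have hspan : Submodule.span R (Set.range fun i => (B i : ι → R)) = N.comap φ := by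
      have := congrArg (Submodule.map (N.comap φ).subtype) B.span_eq
      rw [Submodule.map_span, Submodule.map_subtype_top, ← Set.range_comp] at this
      exact this
    refine ⟨Function.extend e (fun i => φ (B i)) 0, ?_⟩
    have hN : N = Submodule.span R (Set.range fun i => φ (B i)) := by
      have h := Submodule.map_comap_eq_of_le (f := φ) (p := N) (by simp [hφ])
      rw [← hspan, Submodule.map_span, ← Set.range_comp] at h
      exact h.symm
    refine le_antisymm ?_ ?_
    · rw [Submodule.span_le]
      rintro _ ⟨i, rfl⟩
      by_cases h : ∃ j, e j = i
      · obtain ⟨j, rfl⟩ := h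
        rw [e.injective.extend_apply]
        exact (B j).2
      · simp [Function.extend_apply' _ _ _ h]
    · conv_lhs => rw [hN]
      refine Submodule.span_mono ?_
      rintro _ ⟨i, rfl⟩
      exact ⟨e i, by simp [e.injective.extend_apply]⟩
  calc Nat.card (Submodule R M) ≤ Nat.card (ι → M) := Nat.card_le_card_of_surjective _ hsurj
    _ = _ := by simp [Nat.card_fun]

/-- If the orbits of `c` vectors under `f` span `V`, then `f` has at most `|V| ^ c` invariant
subspaces. -/
theorem card_invtSubmodule_le_pow {F V ι : Type*} [Field F] [AddCommGroup V]
    [Module F V] [Finite V] [Fintype ι] (f : V →ₗ[F] V) (b : ι → V)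
    (hb : Submodule.span F (Set.range fun p : ι × ℕ => (f ^ p.2) (b p.1)) = ⊤) :
    Nat.card {U : Submodule F V // U.map f ≤ U} ≤ Nat.card V ^ Fintype.card ι := by
  have : Finite (Module.AEval' f) := Finite.of_equiv V (Module.AEval'.of f).toEquiv
  have hb' : Submodule.span (Polynomial F) (Set.range (Module.AEval'.of f ∘ b)) = ⊤ := by
    rw [eq_top_iff]
    rintro x -
    obtain ⟨x, rfl⟩ := (Module.AEval'.of f).surjective x
    have hx : x ∈ Submodule.span F (Set.range fun p : ι × ℕ => (f ^ p.2) (b p.1)) := by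
      rw [hb]; trivial
    induction hx using Submodule.span_induction with
    | mem x h =>
      obtain ⟨⟨i, n⟩, rfl⟩ := h
      have := Module.AEval'.X_pow_smul_of f (b i) n
      simp only [Module.End.smul_def] at this
      rw [← this]
      exact Submodule.smul_mem _ _ (Submodule.subset_span ⟨i, rfl⟩)
    | zero => simp
    | add x y _ _ hx hy => rw [map_add]; exact add_mem hx hy
    | smul a x _ hx =>
      rw [map_smul, ← Module.AEval.C_smul]
      exact Submodule.smul_mem _ _ hx
  calc Nat.card {U : Submodule F V // U.map f ≤ U}
      = Nat.card (Submodule (Polynomial F) (Module.AEval' f)) :=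
        Nat.card_congr ((Equiv.subtypeEquivRight fun U => by
          rw [Submodule.map_le_iff_le_comap]; rfl).trans
          (Module.AEval.mapSubmodule F V f).toEquiv)
    _ ≤ _ := card_submodule_le_pow _ hb'
    _ = _ := by rw [Nat.card_congr (Module.AEval'.of f).toEquiv]

/-- The number of subspaces of a `d`-dimensional space. -/
noncomputable def cardSubspaces (F : Type*) [Field F] (d : ℕ) : ℕ :=
  Nat.card (Submodule F (Fin d → F))

theorem card_submodule_eq {F V : Type*} [Field F] [AddCommGroup V] [Module F V]
    [Module.Finite F V] : Nat.card (Submodule F V) = cardSubspaces F (Module.finrank F V) :=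
  Nat.card_congr (Submodule.orderIsoMapComap (Module.finBasis F V).equivFun).toEquiv

theorem card_Icc_submodule_le {F V : Type*} [Field F] [AddCommGroup V] [Module F V]
    [Finite V] (B C : Submodule F V) (h : B ≤ C) :
    Nat.card {U : Submodule F V // B ≤ U ∧ U ≤ C} ≤
      cardSubspaces F (Module.finrank F C - Module.finrank F B) := by
  have hfin : Module.Finite F V := Module.Finite.of_finite
  have h1 : Module.finrank F (C ⧸ B.submoduleOf C) =
      Module.finrank F C - Module.finrank F B := by
    rw [Submodule.finrank_quotient, LinearEquiv.finrank_eq (Submodule.submoduleOfEquivOfLe h)]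
  have : Finite (C ⧸ B.submoduleOf C) :=
    Finite.of_surjective _ (Submodule.mkQ_surjective (B.submoduleOf C))
  have : Finite (Submodule F (C ⧸ B.submoduleOf C)) :=
    Finite.of_injective (fun U => (U : Set (C ⧸ B.submoduleOf C))) SetLike.coe_injective
  rw [← h1, ← card_submodule_eq]
  refine Nat.card_le_card_of_injective
    (fun U => (U.1.comap C.subtype).map (B.submoduleOf C).mkQ) ?_
  rintro ⟨U, hU1, hU2⟩ ⟨U', hU1', hU2'⟩ hEq
  have key : ∀ W : Submodule F V, B ≤ W → W ≤ C →
      (((W.comap C.subtype).map (B.submoduleOf C).mkQ).comap (B.submoduleOf C).mkQ).map C.subtype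
        = W := by
    intro W h1 h2
    rw [Submodule.comap_map_mkQ, sup_eq_right.2 (Submodule.comap_mono h1),
      Submodule.map_comap_subtype, inf_eq_right.2 h2]
  have := key U hU1 hU2
  simp only at hEq
  rw [hEq, key U' hU1' hU2'] at this
  exact Subtype.ext this.symm

/-- Rank bound for the number of invariant subspaces. -/
theorem card_invtSubmodule_le_mul {F V : Type*} [Field F] [AddCommGroup V] [Module F V]
    [Finite V] (N : V →ₗ[F] V) :
    Nat.card {U : Submodule F V // U.map N ≤ U} ≤
      cardSubspaces F (Module.finrank F (LinearMap.range N)) *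
        cardSubspaces F (Module.finrank F (LinearMap.ker N)) := by
  have hfin : Module.Finite F V := Module.Finite.of_finite
  have hf : Finite (Submodule F V) :=
    Finite.of_injective (fun U => (U : Set V)) SetLike.coe_injective
  have hf2 : Finite (Submodule F (LinearMap.range N)) :=
    Finite.of_injective (fun U => (U : Set (LinearMap.range N))) SetLike.coe_injective
  have := Fintype.ofFinite (Submodule F (LinearMap.range N))
  let T (B : Submodule F (LinearMap.range N)) : Type _ :=
    {U : Submodule F V // B.map (LinearMap.range N).subtype ≤ U ∧
      U ≤ (B.map (LinearMap.range N).subtype).comap N}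
  have hT (B) : Nat.card (T B) ≤ cardSubspaces F (Module.finrank F (LinearMap.ker N)) := by
    set B' := B.map (LinearMap.range N).subtype with hB'
    by_cases h : B' ≤ B'.comap N
    · have h2 := card_Icc_submodule_le B' (B'.comap N) h
      have h3 : Module.finrank F (B'.comap N) - Module.finrank F B' =
          Module.finrank F (LinearMap.ker N) := by
        have h4 := LinearMap.finrank_range_add_finrank_ker (N.domRestrict (B'.comap N))
        have h5 : LinearMap.range (N.domRestrict (B'.comap N)) = B' := by
          rw [LinearMap.range_domRestrict, Submodule.map_comap_eq_of_le]
          exact Submodule.map_subtype_le _ _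
        have h6 : Module.finrank F (LinearMap.ker (N.domRestrict (B'.comap N))) =
            Module.finrank F (LinearMap.ker N) := by
          rw [LinearMap.ker_domRestrict]
          exact LinearEquiv.finrank_eq (Submodule.comapSubtypeEquivOfLe
            (Submodule.comap_mono bot_le))
        rw [h5, h6] at h4
        omega
      rwa [h3] at h2
    · have : IsEmpty (T B) := ⟨fun U => h (U.2.1.trans U.2.2)⟩
      simp
  calc Nat.card {U : Submodule F V // U.map N ≤ U}
      ≤ Nat.card (Σ B, T B) := by
        refine Nat.card_le_card_of_injective (fun U =>
          ⟨(U.1.map N).comap (LinearMap.range N).subtype, U.1, ?_, ?_⟩) ?_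
        · rw [Submodule.map_comap_subtype]
          exact inf_le_right.trans U.2
        · rw [Submodule.map_comap_subtype, inf_eq_right.2 LinearMap.map_le_range]
          exact Submodule.le_comap_map _ _
        · rintro U U' h
          have := congrArg (fun x : Σ B, T B => x.2.1) h
          exact Subtype.ext this
    _ = ∑ B, Nat.card (T B) := Nat.card_sigma
    _ ≤ ∑ _B : Submodule F (LinearMap.range N), cardSubspaces F (Module.finrank F (LinearMap.ker N)) :=
        Finset.sum_le_sum fun B _ => hT B
    _ = _ := by
        rw [Finset.sum_const, smul_eq_mul, Finset.card_univ, ← Nat.card_eq_fintype_card,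
          card_submodule_eq]

theorem card_grassmannian_mul {F V : Type*} [Field F] [Fintype F] [AddCommGroup V] [Module F V]
    [Finite V] (k : ℕ) (hk : k ≤ Module.finrank F V) :
    Nat.card {U : Submodule F V // Module.finrank F U = k} *
        ∏ i : Fin k, (Fintype.card F ^ k - Fintype.card F ^ i.val) =
      ∏ i : Fin k, (Fintype.card F ^ Module.finrank F V - Fintype.card F ^ i.val) := by
  have hfin : Module.Finite F V := Module.Finite.of_finite
  have hf : Finite (Submodule F V) :=
    Finite.of_injective (fun U => (U : Set V)) SetLike.coe_injective
  have := Fintype.ofFinite {U : Submodule F V // Module.finrank F U = k}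
  let T (U : {U : Submodule F V // Module.finrank F U = k}) : Type _ :=
    {s : Fin k → U.1 // LinearIndependent F s}
  have hT (U) : Nat.card (T U) = ∏ i : Fin k, (Fintype.card F ^ k - Fintype.card F ^ i.val) := by
    have := card_linearIndependent (K := F) (V := U.1) (k := k) U.2.ge
    rwa [U.2] at this
  have hspan (U) (t : T U) : Submodule.span F (Set.range fun i => (t.1 i : V)) = U.1 := by
    have h := t.2.span_eq_top_of_card_eq_finrank' (by simp [U.2])
    have := congrArg (Submodule.map U.1.subtype) h
    rw [Submodule.map_span, Submodule.map_subtype_top, ← Set.range_comp] at this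
    exact this
  rw [← card_linearIndependent hk]
  calc _ = ∑ U, Nat.card (T U) := by simp [hT]
    _ = Nat.card (Σ U, T U) := Nat.card_sigma.symm
    _ = _ := by
      refine Nat.card_eq_of_bijective (fun x : Σ U, T U => ⟨fun i => (x.2.1 i : V),
        x.2.2.map' x.1.1.subtype (Submodule.ker_subtype _)⟩) ⟨?_, ?_⟩
      · rintro ⟨U, t⟩ ⟨U', t'⟩ h
        have h' : (fun i => (t.1 i : V)) = fun i => (t'.1 i : V) := congrArg Subtype.val h
        have hU : U = U' := by
          apply Subtype.ext
          rw [← hspan U t, ← hspan U' t', h']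
        subst hU
        congr 1
        refine Subtype.ext (funext fun i => Subtype.ext (congrFun h' i))
      · rintro ⟨s, hs⟩
        refine ⟨⟨⟨Submodule.span F (Set.range s), by simpa using finrank_span_eq_card hs⟩,
          fun i => ⟨s i, Submodule.subset_span ⟨i, rfl⟩⟩, ?_⟩, rfl⟩
        exact LinearIndependent.of_comp (Submodule.span F (Set.range s)).subtype hs
section Perm

/-- The number of cycles of a permutation, fixed points included. -/
noncomputable def cardCycles {α : Type*} (σ : Equiv.Perm α) : ℕ :=
  Nat.card (Quotient (Equiv.Perm.SameCycle.setoid σ))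

theorem two_mul_cardCycles_add_card_support_le {α : Type*} [Fintype α] [DecidableEq α]
    (σ : Equiv.Perm α) :
    2 * cardCycles σ + σ.support.card ≤ 2 * Fintype.card α := by
  classical
  let r : Quotient (Equiv.Perm.SameCycle.setoid σ) → α := Quotient.out
  have hr : ∀ x y, σ.SameCycle (r x) (r y) → x = y := by
    intro x y h
    rw [← Quotient.out_eq x, ← Quotient.out_eq y]
    exact Quotient.sound h
  have hs : ∀ a, σ.SameCycle (σ a) a := fun a => Equiv.Perm.sameCycle_apply_left.2 (.refl _ _)
  let g : Bool × Quotient (Equiv.Perm.SameCycle.setoid σ) → α ⊕ (σ.supportᶜ : Finset α) :=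
    fun p => if p.1 then Sum.inl (r p.2) else
      if h : σ (r p.2) = r p.2 then Sum.inr ⟨r p.2, by simpa using h⟩ else Sum.inl (σ (r p.2))
  have hg : Function.Injective g := by
    rintro ⟨x, a⟩ ⟨y, b⟩ h
    have h2 : a = b := by
      apply hr
      cases x <;> cases y <;> simp only [g, Bool.false_eq_true, if_true, if_false] at h
      all_goals try split_ifs at h
      all_goals simp only [Sum.inl.injEq, Sum.inr.injEq, Subtype.mk.injEq] at h
      · rw [h]
      · rw [← Equiv.Perm.sameCycle_apply_left, h]; exact hs _
      · rw [← h]; exact (hs _).symm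
      · rw [h]; exact hs _
      · rw [h]
    subst h2
    cases x <;> cases y <;> simp only [g, Bool.false_eq_true, if_true, if_false] at h ⊢ <;>
        split_ifs at h with h3 <;> simp only [Sum.inl.injEq] at h
    · exact (h3 h).elim
    · exact (h3 h.symm).elim
  have h1 := Nat.card_le_card_of_injective g hg
  rw [Nat.card_prod, Nat.card_sum] at h1
  simp only [Nat.card_eq_fintype_card, Fintype.card_bool, Fintype.card_coe,
    Finset.card_compl] at h1
  have h2 := Finset.card_le_univ σ.support
  have h3 : cardCycles σ = Fintype.card (Quotient (Equiv.Perm.SameCycle.setoid σ)) :=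
    Nat.card_eq_fintype_card
  omega

/-- Generating function bound for the number of moved points of a permutation. -/
theorem sum_pow_card_support_le {α : Type*} [Fintype α] [DecidableEq α]
    (z : ℝ) (hz : 0 ≤ z) :
    ∑ σ : Equiv.Perm α, z ^ σ.support.card ≤ (1 + Fintype.card α * z) ^ Fintype.card α := by
  have h1 (σ : Equiv.Perm α) : z ^ σ.support.card = ∏ i, if σ i = i then 1 else z := by
    rw [Finset.prod_ite, Finset.prod_const_one, one_mul, Finset.prod_const]
    rfl
  calc ∑ σ : Equiv.Perm α, z ^ σ.support.card
      = ∑ σ : Equiv.Perm α, ∏ i, if σ i = i then 1 else z := by simp_rw [h1]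
    _ = ∑ f ∈ Finset.univ.image (fun σ : Equiv.Perm α => (σ : α → α)),
          ∏ i, if f i = i then 1 else z := by
        rw [Finset.sum_image]
        intro σ _ τ _ h
        exact DFunLike.coe_injective h
    _ ≤ ∑ f : α → α, ∏ i, if f i = i then 1 else z := by
        refine Finset.sum_le_sum_of_subset_of_nonneg (Finset.subset_univ _) fun f _ _ => ?_
        exact Finset.prod_nonneg fun i _ => by split_ifs <;> positivity
    _ = ∏ i : α, ∑ j : α, if j = i then 1 else z := by
        rw [Finset.prod_univ_sum, Fintype.piFinset_univ]
    _ ≤ ∏ i : α, (1 + Fintype.card α * z) := by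
        refine Finset.prod_le_prod (fun i _ => Finset.sum_nonneg fun j _ => by
          split_ifs <;> positivity) fun i _ => ?_
        rw [← Finset.add_sum_erase _ _ (Finset.mem_univ i), if_pos rfl]
        gcongr
        calc _ ≤ ∑ j ∈ Finset.univ.erase i, z :=
              Finset.sum_le_sum fun j hj => by simp [Finset.ne_of_mem_erase hj]
          _ ≤ _ := by
              rw [Finset.sum_const, nsmul_eq_mul]
              gcongr
              exact_mod_cast Finset.card_le_univ _
    _ = _ := by simp

theorem funLeft_pow_apply {α : Type*} (F : Type*) [Field F]
    (σ : Equiv.Perm α) (j : ℕ) (v : α → F) (i : α) :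
    (LinearMap.funLeft F F σ ^ j) v i = v ((σ ^ j) i) := by
  induction j generalizing i with
  | zero => rfl
  | succ j ih => rw [pow_succ', Module.End.mul_apply, LinearMap.funLeft_apply, ih, pow_succ,
      Equiv.Perm.mul_apply]

theorem span_funLeft_pow_eq_top {α : Type*} [Fintype α] [DecidableEq α]
    (F : Type*) [Field F] (σ : Equiv.Perm α) :
    Submodule.span F (Set.range fun p : Quotient (Equiv.Perm.SameCycle.setoid σ) × ℕ =>
      (LinearMap.funLeft F F σ ^ p.2) (Pi.single p.1.out 1)) = ⊤ := by
  rw [eq_top_iff, ← (Pi.basisFun F α).span_eq]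
  refine Submodule.span_mono ?_
  rintro _ ⟨i, rfl⟩
  have h : σ.SameCycle i (Quotient.mk (Equiv.Perm.SameCycle.setoid σ) i).out :=
    (Quotient.mk_out (s := Equiv.Perm.SameCycle.setoid σ) i).symm
  obtain ⟨j, hj⟩ := h.exists_nat_pow_eq
  refine ⟨(Quotient.mk _ i, j), ?_⟩
  funext x
  simp only [funLeft_pow_apply, Pi.basisFun_apply, Pi.single_apply, ← hj,
    EmbeddingLike.apply_eq_iff_eq]

theorem finrank_ker_funLeft_sub_one {α : Type*} [Fintype α]
    (F : Type*) [Field F] (σ : Equiv.Perm α) :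
    Module.finrank F (LinearMap.ker (LinearMap.funLeft F F σ - 1)) = cardCycles σ := by
  have h1 : LinearMap.ker (LinearMap.funLeft F F σ - 1) =
      LinearMap.range (LinearMap.funLeft F F
        (Quotient.mk (Equiv.Perm.SameCycle.setoid σ))) := by
    ext v
    rw [LinearMap.mem_ker, LinearMap.sub_apply, sub_eq_zero]
    constructor
    · intro h
      have h2 (j : ℕ) : (LinearMap.funLeft F F σ ^ j) v = v := by
        induction j with
        | zero => rfl
        | succ j ih => rw [pow_succ, Module.End.mul_apply, h]; exact ih
      refine ⟨fun x => x.lift v fun a b hab => ?_, rfl⟩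
      obtain ⟨j, hj⟩ := Equiv.Perm.SameCycle.exists_nat_pow_eq hab
      rw [← hj, ← funLeft_pow_apply F σ j v, h2]
    · rintro ⟨w, rfl⟩
      funext i
      simp only [LinearMap.funLeft_apply, Module.End.one_apply]
      congr 1
      exact Quotient.sound (Equiv.Perm.sameCycle_apply_left.2 (.refl σ i))
  rw [h1, LinearMap.finrank_range_of_inj
    (LinearMap.funLeft_injective_of_surjective F F _ Quotient.mk_surjective)]
  classical
  rw [Module.finrank_fintype_fun_eq_card, cardCycles, Nat.card_eq_fintype_card]

theorem finrank_range_funLeft_sub_one_add {α : Type*} [Fintype α]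
    (F : Type*) [Field F] (σ : Equiv.Perm α) :
    Module.finrank F (LinearMap.range (LinearMap.funLeft F F σ - 1)) + cardCycles σ =
      Fintype.card α := by
  rw [← finrank_ker_funLeft_sub_one F, LinearMap.finrank_range_add_finrank_ker,
    Module.finrank_fintype_fun_eq_card]

end Perm

section Burnside

variable (F : Type) [Field F]

theorem mem_PermGroup {n : ℕ} (M : GL (Fin n) F) : M ∈ PermGroup F n ↔ M ∈ permSet F n := by
  refine ⟨fun h => ?_, fun h => Subgroup.subset_closure h⟩
  induction h using Subgroup.closure_induction with
  | mem x hx => exact hx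
  | one => exact ⟨1, by simp [Equiv.Perm.permMatrix]⟩
  | mul x y _ _ hx hy =>
    obtain ⟨σ, hσ⟩ := hx
    obtain ⟨τ, hτ⟩ := hy
    exact ⟨τ * σ, by rw [Units.val_mul, hσ, hτ, Matrix.permMatrix_mul]⟩
  | inv x _ hx =>
    obtain ⟨σ, hσ⟩ := hx
    refine ⟨σ⁻¹, ?_⟩
    rw [← Units.mul_eq_one_iff_inv_eq, hσ, ← Matrix.permMatrix_mul]
    simp

theorem toLin'_permMatrix {n : ℕ} (σ : Equiv.Perm (Fin n)) :
    Matrix.toLin' (σ.permMatrix F) = LinearMap.funLeft F F σ := by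
  refine LinearMap.ext fun v => ?_
  rw [Matrix.toLin'_apply, Matrix.permMatrix_mulVec]
  rfl

/-- The permutation action on the Grassmannian. -/
instance grassmannianAction (n k : ℕ) : MulAction (Equiv.Perm (Fin n))
    {V : Submodule F (Fin n → F) // Module.finrank F V = k} where
  smul σ V := ⟨V.1.map (LinearMap.funLeft F F ⇑σ⁻¹), by
    rw [← (Submodule.equivMapOfInjective _
      (LinearMap.funLeft_injective_of_surjective F F _ (σ⁻¹).surjective) V.1).finrank_eq]
    exact V.2⟩
  one_smul V := Subtype.ext (Submodule.map_id _)
  mul_smul σ τ V := Subtype.ext <| by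
    change V.1.map (LinearMap.funLeft F F ⇑(σ * τ)⁻¹) =
      (V.1.map (LinearMap.funLeft F F ⇑τ⁻¹)).map (LinearMap.funLeft F F ⇑σ⁻¹)
    rw [_root_.mul_inv_rev, ← Submodule.map_comp]
    rfl

theorem numClassesDim_eq (n k : ℕ) : numClassesDim F (PermGroup F n) k =
    Nat.card (MulAction.orbitRel.Quotient (Equiv.Perm (Fin n))
      {V : Submodule F (Fin n → F) // Module.finrank F V = k}) := by
  refine Nat.card_congr (Quot.congrRight fun V W => ?_)
  rw [MulAction.orbitRel_apply, MulAction.mem_orbit_symm, MulAction.mem_orbit_iff]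
  constructor
  · rintro ⟨M, hM, h⟩
    obtain ⟨σ, hσ⟩ := (mem_PermGroup F M).1 hM
    rw [hσ, toLin'_permMatrix] at h
    exact ⟨σ⁻¹, Subtype.ext (by rw [← h]; exact congrArg (fun τ : Equiv.Perm (Fin n) => V.1.map (LinearMap.funLeft F F τ)) (inv_inv σ))⟩
  · rintro ⟨σ, h⟩
    refine ⟨⟨σ⁻¹.permMatrix F, σ.permMatrix F, ?_, ?_⟩,
      (mem_PermGroup F _).2 ⟨σ⁻¹, rfl⟩, ?_⟩
    · rw [← Matrix.permMatrix_mul]; simp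
    · rw [← Matrix.permMatrix_mul]; simp
    · simp only [toLin'_permMatrix]
      exact congrArg Subtype.val h

/-- Burnside's lemma for the permutation action on the Grassmannian. -/
theorem numClassesDim_mul_factorial [Finite F] (n k : ℕ) :
    numClassesDim F (PermGroup F n) k * n.factorial = ∑ σ : Equiv.Perm (Fin n),
      Nat.card (MulAction.fixedBy {V : Submodule F (Fin n → F) // Module.finrank F V = k} σ) := by
  classical
  have hf : Finite (Submodule F (Fin n → F)) :=
    Finite.of_injective (fun U => (U : Set (Fin n → F))) SetLike.coe_injective
  have := Fintype.ofFinite {V : Submodule F (Fin n → F) // Module.finrank F V = k}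
  have := Fintype.ofFinite (MulAction.orbitRel.Quotient (Equiv.Perm (Fin n))
      {V : Submodule F (Fin n → F) // Module.finrank F V = k})
  have h := MulAction.sum_card_fixedBy_eq_card_orbits_mul_card_group (Equiv.Perm (Fin n))
    {V : Submodule F (Fin n → F) // Module.finrank F V = k}
  rw [numClassesDim_eq, Nat.card_eq_fintype_card]
  simp only [Nat.card_eq_fintype_card]
  rw [h, Fintype.card_perm, Fintype.card_fin]

theorem map_funLeft_eq_of_mem_fixedBy {n k : ℕ} {σ : Equiv.Perm (Fin n)}
    {V : {V : Submodule F (Fin n → F) // Module.finrank F V = k}}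
    (hV : V ∈ MulAction.fixedBy {V : Submodule F (Fin n → F) // Module.finrank F V = k} σ) :
    V.1.map (LinearMap.funLeft F F σ) = V.1 := by
  have h1 : σ⁻¹ • V = V := by rw [inv_smul_eq_iff]; exact hV.symm
  have h2 : V.1.map (LinearMap.funLeft F F ⇑σ⁻¹⁻¹) = V.1 := congrArg Subtype.val h1
  rwa [inv_inv] at h2

theorem card_fixedBy_le_card_subtype [Finite F] {n k : ℕ} {σ : Equiv.Perm (Fin n)}
    {P : Submodule F (Fin n → F) → Prop}
    (hP : ∀ V, V.map (LinearMap.funLeft F F σ) = V → P V) :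
    Nat.card (MulAction.fixedBy {V : Submodule F (Fin n → F) // Module.finrank F V = k} σ) ≤
      Nat.card {V // P V} := by
  have hf : Finite (Submodule F (Fin n → F)) :=
    Finite.of_injective (fun U => (U : Set (Fin n → F))) SetLike.coe_injective
  let g (V : MulAction.fixedBy {V : Submodule F (Fin n → F) // Module.finrank F V = k} σ) :
      {V // P V} := ⟨V.1.1, hP _ (map_funLeft_eq_of_mem_fixedBy F V.2)⟩
  exact Nat.card_le_card_of_injective g fun V W h =>
    Subtype.ext (Subtype.ext (congrArg (fun x : {V // P V} => x.1) h))

theorem card_fixedBy_le_mul [Finite F] (n k : ℕ) (σ : Equiv.Perm (Fin n)) :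
    Nat.card (MulAction.fixedBy {V : Submodule F (Fin n → F) // Module.finrank F V = k} σ) ≤
      cardSubspaces F (n - cardCycles σ) * cardSubspaces F (cardCycles σ) := by
  have h1 := finrank_range_funLeft_sub_one_add F σ
  rw [Fintype.card_fin] at h1
  have h2 := card_invtSubmodule_le_mul (LinearMap.funLeft F F σ - 1)
  rw [finrank_ker_funLeft_sub_one, Nat.eq_sub_of_add_eq h1] at h2
  refine le_trans (card_fixedBy_le_card_subtype F fun V hV => ?_) h2
  rintro _ ⟨x, hx, rfl⟩
  refine sub_mem ?_ hx
  have h := Submodule.mem_map_of_mem (f := LinearMap.funLeft F F σ) hx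
  rwa [hV] at h

theorem card_fixedBy_le_pow [Fintype F] (n k : ℕ) (σ : Equiv.Perm (Fin n)) :
    Nat.card (MulAction.fixedBy {V : Submodule F (Fin n → F) // Module.finrank F V = k} σ) ≤
      Fintype.card F ^ (n * cardCycles σ) := by
  have := Fintype.ofFinite (Quotient (Equiv.Perm.SameCycle.setoid σ))
  have h2 := card_invtSubmodule_le_pow (LinearMap.funLeft F F σ)
    (fun x : Quotient (Equiv.Perm.SameCycle.setoid σ) => Pi.single x.out (1 : F))
    (span_funLeft_pow_eq_top F σ)
  have h3 : Nat.card (Fin n → F) = Fintype.card F ^ n := by simp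
  have h4 : Fintype.card (Quotient (Equiv.Perm.SameCycle.setoid σ)) = cardCycles σ :=
    Nat.card_eq_fintype_card.symm
  rw [h3, h4, ← pow_mul] at h2
  exact le_trans (card_fixedBy_le_card_subtype F fun V hV => hV.le) h2

end Burnside

section Kq

variable {q : ℕ}

theorem Kq_factor_pos (hq : 2 ≤ q) (j : ℕ) : 0 < 1 - ((q : ℝ))⁻¹ ^ (j + 1) := by
  have h : (1 : ℝ) < q := by exact_mod_cast hq
  exact sub_pos.2 (pow_lt_one₀ (by positivity) (inv_lt_one_of_one_lt₀ h) (by omega))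

theorem KqTrunc_pos (hq : 2 ≤ q) (k : ℕ) : 0 < KqTrunc q k :=
  Finset.prod_pos fun j _ => Kq_factor_pos hq j

theorem KqTrunc_antitone (hq : 2 ≤ q) : Antitone (KqTrunc q) := by
  refine antitone_nat_of_succ_le fun k => ?_
  rw [KqTrunc, Finset.prod_range_succ]
  refine mul_le_of_le_one_right (KqTrunc_pos hq k).le ?_
  have : (0 : ℝ) ≤ ((q : ℝ))⁻¹ ^ (k + 1) := by positivity
  linarith

theorem summable_neg_inv_pow (hq : 2 ≤ q) : Summable fun j : ℕ => -((q : ℝ))⁻¹ ^ (j + 1) := by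
  have h : (1 : ℝ) < q := by exact_mod_cast hq
  exact ((summable_nat_add_iff 1).2 (summable_geometric_of_lt_one (by positivity)
    (inv_lt_one_of_one_lt₀ h))).neg

theorem tendsto_KqTrunc (hq : 2 ≤ q) : Tendsto (KqTrunc q) atTop (𝓝 (Kq q)) := by
  have h := Real.multipliable_one_add_of_summable (summable_neg_inv_pow hq)
  simp only [← sub_eq_add_neg] at h
  exact h.hasProd.tendsto_prod_nat

theorem Kq_le_KqTrunc (hq : 2 ≤ q) (k : ℕ) : Kq q ≤ KqTrunc q k :=
  (KqTrunc_antitone hq).le_of_tendsto (tendsto_KqTrunc hq) k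

theorem Kq_pos (hq : 2 ≤ q) : 0 < Kq q := by
  refine lt_of_le_of_ne (ge_of_tendsto' (tendsto_KqTrunc hq) fun k => (KqTrunc_pos hq k).le) ?_
  have h := tprod_one_add_ne_zero_of_summable (f := fun j : ℕ => -((q : ℝ))⁻¹ ^ (j + 1))
    (fun j => by
      rw [← sub_eq_add_neg]
      exact (Kq_factor_pos hq j).ne') (summable_neg_inv_pow hq).norm
  simp only [← sub_eq_add_neg] at h
  exact h.symm

theorem prod_pow_sub_pow_mul_KqTrunc (hq : 2 ≤ q) (m k : ℕ) (hk : k ≤ m) :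
    ((∏ i : Fin k, (q ^ m - q ^ i.val) : ℕ) : ℝ) * KqTrunc q (m - k) =
      (q : ℝ) ^ (m * k) * KqTrunc q m := by
  have hq0 : (q : ℝ) ≠ 0 := by positivity
  induction k with
  | zero => simp
  | succ k ih =>
    have h1 : KqTrunc q (m - k) =
        KqTrunc q (m - (k + 1)) * (1 - ((q : ℝ))⁻¹ ^ (m - k)) := by
      obtain ⟨d, rfl⟩ := Nat.exists_eq_add_of_le hk
      have e1 : k + 1 + d - k = d + 1 := by omega
      have e2 : k + 1 + d - (k + 1) = d := by omega
      rw [e1, e2, KqTrunc, Finset.prod_range_succ, KqTrunc]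
    have h2 : ((q ^ m - q ^ k : ℕ) : ℝ) = (q : ℝ) ^ m * (1 - ((q : ℝ))⁻¹ ^ (m - k)) := by
      obtain ⟨d, rfl⟩ := Nat.exists_eq_add_of_le (Nat.le_of_succ_le hk)
      rw [Nat.cast_sub (Nat.pow_le_pow_right (by omega) (by omega)), Nat.add_sub_cancel_left]
      push_cast
      rw [pow_add, inv_pow]
      field_simp
    rw [Fin.prod_univ_castSucc, Nat.cast_mul, mul_add, pow_add, mul_one]
    simp only [Fin.val_castSucc, Fin.val_last]
    have h3 := ih (Nat.le_of_succ_le hk)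
    rw [h1] at h3
    rw [h2]
    linear_combination (q : ℝ) ^ m * h3

end Kq

section Count

variable {F : Type*} [Field F] [Fintype F]

theorem two_le_card : 2 ≤ Fintype.card F := Fintype.one_lt_card

/-- The number of `k`-dimensional subspaces of `F^n`. -/
theorem card_grassmannian (n k : ℕ) (hk : k ≤ n) :
    (Nat.card {U : Submodule F (Fin n → F) // Module.finrank F U = k} : ℝ) =
      (Fintype.card F : ℝ) ^ (k * (n - k)) *
        (KqTrunc (Fintype.card F) n /
          (KqTrunc (Fintype.card F) (n - k) * KqTrunc (Fintype.card F) k)) := by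
  have hq := two_le_card (F := F)
  have h := card_grassmannian_mul (F := F) (V := Fin n → F) k (by simpa using hk)
  rw [Module.finrank_fintype_fun_eq_card, Fintype.card_fin] at h
  have h' := congrArg (Nat.cast : ℕ → ℝ) h
  rw [Nat.cast_mul] at h'
  have h1 := prod_pow_sub_pow_mul_KqTrunc hq n k hk
  have h2 := prod_pow_sub_pow_mul_KqTrunc hq k k le_rfl
  have h0 : KqTrunc (Fintype.card F) 0 = 1 := by simp [KqTrunc]
  rw [Nat.sub_self, h0, mul_one] at h2
  rw [← h', h2] at h1
  have p1 := KqTrunc_pos hq k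
  have p2 := KqTrunc_pos hq (n - k)
  have hq0 : (Fintype.card F : ℝ) ≠ 0 := by positivity
  have e : n * k = k * k + k * (n - k) := by
    rw [← mul_add, Nat.add_sub_cancel' hk, mul_comm]
  rw [e, pow_add] at h1
  field_simp
  apply mul_left_cancel₀ (pow_ne_zero (k * k) hq0)
  linear_combination h1

theorem card_grassmannian_le (n k : ℕ) (hk : k ≤ n) :
    (Nat.card {U : Submodule F (Fin n → F) // Module.finrank F U = k} : ℝ) ≤
      (Fintype.card F : ℝ) ^ (k * (n - k)) * (Kq (Fintype.card F))⁻¹ := by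
  have hq := two_le_card (F := F)
  rw [card_grassmannian n k hk]
  gcongr
  have p1 := KqTrunc_pos hq (n - k)
  have p2 := KqTrunc_pos hq k
  rw [div_mul_eq_div_div, div_le_iff₀ p2]
  calc KqTrunc (Fintype.card F) n / KqTrunc (Fintype.card F) (n - k) ≤ 1 := by
        rw [div_le_one p1]
        exact KqTrunc_antitone hq (Nat.sub_le _ _)
    _ ≤ (Kq (Fintype.card F))⁻¹ * KqTrunc (Fintype.card F) k := by
        rw [← inv_mul_cancel₀ (Kq_pos hq).ne']
        have := Kq_pos hq
        gcongr
        exact Kq_le_KqTrunc hq k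

theorem cardSubspaces_le (d : ℕ) :
    (cardSubspaces F d : ℝ) ≤
      (d + 1) * (Kq (Fintype.card F))⁻¹ * (Fintype.card F : ℝ) ^ ((d : ℝ) ^ 2 / 4) := by
  have hq := two_le_card (F := F)
  have hq1 : (1 : ℝ) ≤ Fintype.card F := by exact_mod_cast hq.trans' one_le_two
  have hK := Kq_pos hq
  have hf : Finite (Submodule F (Fin d → F)) :=
    Finite.of_injective (fun U => (U : Set (Fin d → F))) SetLike.coe_injective
  have := Fintype.ofFinite (Submodule F (Fin d → F))
  have h1 : cardSubspaces F d = ∑ k ∈ Finset.range (d + 1),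
      Nat.card {U : Submodule F (Fin d → F) // Module.finrank F U = k} := by
    rw [cardSubspaces, Nat.card_eq_fintype_card, ← Finset.card_univ,
      Finset.card_eq_sum_card_fiberwise (f := fun U : Submodule F (Fin d → F) =>
        Module.finrank F U) (t := Finset.range (d + 1))]
    · simp [Nat.card_eq_fintype_card, Fintype.card_subtype]
    · intro U _
      have := Submodule.finrank_le U
      rw [Module.finrank_fintype_fun_eq_card, Fintype.card_fin] at this
      simpa [Nat.lt_succ_iff] using this
  rw [h1, Nat.cast_sum]
  calc _ ≤ ∑ k ∈ Finset.range (d + 1),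
        (Kq (Fintype.card F))⁻¹ * (Fintype.card F : ℝ) ^ ((d : ℝ) ^ 2 / 4) := by
        refine Finset.sum_le_sum fun k hk => ?_
        have hkd : k ≤ d := Nat.lt_succ_iff.1 (Finset.mem_range.1 hk)
        refine (card_grassmannian_le d k hkd).trans ?_
        rw [mul_comm, ← Real.rpow_natCast]
        gcongr
        push_cast [hkd]
        nlinarith [sq_nonneg ((d : ℝ) - 2 * k)]
    _ = _ := by
        rw [Finset.sum_const, Finset.card_range, nsmul_eq_mul]
        push_cast
        ring

end Count

theorem card_fixedBy_le_add {F : Type} [Field F] [Fintype F] (n k : ℕ)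
    (σ : Equiv.Perm (Fin n)) :
    (Nat.card (MulAction.fixedBy {V : Submodule F (Fin n → F) // Module.finrank F V = k} σ) : ℝ) ≤
      ((n + 1) * (Kq (Fintype.card F))⁻¹) ^ 2 * (Fintype.card F : ℝ) ^ ((n : ℝ) ^ 2 / 4) *
        ((Fintype.card F : ℝ) ^ (-(n : ℝ) / 32)) ^ σ.support.card +
      (Fintype.card F : ℝ) ^ ((n : ℝ) ^ 2 / 8) := by
  have hq := two_le_card (F := F)
  have hq1 : (1 : ℝ) ≤ Fintype.card F := by exact_mod_cast hq.trans' one_le_two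
  have hq0 : (0 : ℝ) < Fintype.card F := by positivity
  have hK := Kq_pos hq
  set Q : ℝ := (Fintype.card F : ℝ) with hQ
  set K := Kq (Fintype.card F)
  set c := cardCycles σ with hc
  set m := σ.support.card
  have hcn : c ≤ n := by
    have := finrank_range_funLeft_sub_one_add F σ
    rw [Fintype.card_fin] at this
    omega
  have hcm : (2 * c + m : ℝ) ≤ 2 * n := by
    have := two_mul_cardCycles_add_card_support_le σ
    rw [Fintype.card_fin] at this
    exact_mod_cast this
  have hcn' : (c : ℝ) ≤ n := by exact_mod_cast hcn
  by_cases h : (n : ℝ) / 8 ≤ c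
  · refine le_add_of_le_of_nonneg ?_ (by positivity)
    have h1 : (Nat.card (MulAction.fixedBy
        {V : Submodule F (Fin n → F) // Module.finrank F V = k} σ) : ℝ) ≤
        cardSubspaces F (n - c) * cardSubspaces F c := by
      exact_mod_cast card_fixedBy_le_mul F n k σ
    have h2 := cardSubspaces_le (F := F) (n - c)
    have h3 := cardSubspaces_le (F := F) c
    rw [Nat.cast_sub hcn] at h2
    calc _ ≤ _ := h1
      _ ≤ _ := mul_le_mul h2 h3 (by positivity)
        (mul_nonneg (mul_nonneg (by linarith) (by positivity)) (by positivity))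
      _ = ((n - c + 1) * K⁻¹) * ((c + 1) * K⁻¹) * Q ^ (((n : ℝ) - c) ^ 2 / 4 + (c : ℝ) ^ 2 / 4) := by
        rw [Real.rpow_add hq0]
        ring
      _ ≤ ((n + 1) * K⁻¹) * ((n + 1) * K⁻¹) * Q ^ ((n : ℝ) ^ 2 / 4 + -(n : ℝ) / 32 * m) := by
        have hc0 : (0 : ℝ) ≤ c := by positivity
        have hK' : 0 ≤ K⁻¹ := by positivity
        have hexp : ((n : ℝ) - c) ^ 2 / 4 + (c : ℝ) ^ 2 / 4 ≤
            (n : ℝ) ^ 2 / 4 + -(n : ℝ) / 32 * m := by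
          have : (n : ℝ) / 8 * (m / 2) ≤ c * (n - c) :=
            mul_le_mul h (by linarith) (by positivity) hc0
          nlinarith
        exact mul_le_mul (mul_le_mul (mul_le_mul_of_nonneg_right (by linarith) hK')
          (mul_le_mul_of_nonneg_right (by linarith) hK') (by positivity) (by positivity))
          (Real.rpow_le_rpow_of_exponent_le hq1 hexp) (by positivity) (by positivity)
      _ = _ := by
        rw [Real.rpow_add hq0, Real.rpow_mul hq0.le, Real.rpow_natCast]
        ring
  · refine le_add_of_nonneg_of_le (by positivity) ?_
    have h1 : (Nat.card (MulAction.fixedBy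
        {V : Submodule F (Fin n → F) // Module.finrank F V = k} σ) : ℝ) ≤
        Q ^ (n * c) := by
      rw [hQ]
      exact_mod_cast card_fixedBy_le_pow F n k σ
    refine h1.trans ?_
    rw [← Real.rpow_natCast]
    gcongr
    push_cast
    nlinarith [(Nat.cast_nonneg n : (0 : ℝ) ≤ n)]

theorem sum_card_fixedBy_le {F : Type} [Field F] [Fintype F] (n k : ℕ) :
    ∑ σ ∈ (Finset.univ : Finset (Equiv.Perm (Fin n))).erase 1,
      (Nat.card (MulAction.fixedBy
        {V : Submodule F (Fin n → F) // Module.finrank F V = k} σ) : ℝ) ≤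
      ((n + 1) * (Kq (Fintype.card F))⁻¹) ^ 2 * (Fintype.card F : ℝ) ^ ((n : ℝ) ^ 2 / 4) *
        ((1 + n * (Fintype.card F : ℝ) ^ (-(n : ℝ) / 32)) ^ n - 1) +
      n ^ n * (Fintype.card F : ℝ) ^ ((n : ℝ) ^ 2 / 8) := by
  refine (Finset.sum_le_sum fun σ _ => card_fixedBy_le_add n k σ).trans ?_
  rw [Finset.sum_add_distrib, ← Finset.mul_sum, Finset.sum_const, nsmul_eq_mul]
  have hz : (0 : ℝ) ≤ (Fintype.card F : ℝ) ^ (-(n : ℝ) / 32) := by positivity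
  have h := sum_pow_card_support_le (α := Fin n) _ hz
  rw [← Finset.add_sum_erase _ _ (Finset.mem_univ 1), Equiv.Perm.support_one, Finset.card_empty,
    pow_zero, Fintype.card_fin] at h
  gcongr
  · linarith
  · have h1 : ((Finset.univ : Finset (Equiv.Perm (Fin n))).erase 1).card ≤ n ^ n := by
      refine (Finset.card_le_univ _).trans ?_
      rw [Fintype.card_perm, Fintype.card_fin]
      exact Nat.factorial_le_pow n
    exact_mod_cast h1

theorem card_fixedBy_one {F : Type} [Field F] (n k : ℕ) :
    Nat.card (MulAction.fixedBy {V : Submodule F (Fin n → F) // Module.finrank F V = k}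
      (1 : Equiv.Perm (Fin n))) =
      Nat.card {V : Submodule F (Fin n → F) // Module.finrank F V = k} := by
  rw [MulAction.fixedBy_one_eq_univ]
  exact Nat.card_congr (Equiv.Set.univ _)

section Asymptotics

theorem rpow_neg_div_eq_pow {Q : ℝ} (hQ : 1 < Q) (a : ℝ) (n : ℕ) :
    Q ^ (-(n : ℝ) / a) = (Q ^ (-1 / a)) ^ n := by
  rw [← Real.rpow_mul_natCast (by linarith)]
  congr 1
  ring

theorem tendsto_pow_mul_rpow_neg_div {Q : ℝ} (hQ : 1 < Q) {a : ℝ} (ha : 0 < a) (j : ℕ) :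
    Tendsto (fun n : ℕ => (n : ℝ) ^ j * Q ^ (-(n : ℝ) / a)) atTop (𝓝 0) := by
  simp_rw [rpow_neg_div_eq_pow hQ]
  refine tendsto_pow_const_mul_const_pow_of_abs_lt_one j ?_
  rw [abs_of_nonneg (by positivity)]
  exact Real.rpow_lt_one_of_one_lt_of_neg hQ (div_neg_of_neg_of_pos (by norm_num) ha)

theorem one_add_pow_sub_one_le {x : ℝ} (hx : 0 ≤ x) (n : ℕ) (h : n * x ≤ 1) :
    (1 + x) ^ n - 1 ≤ 2 * (n * x) := by
  have h1 : (1 + x) ^ n ≤ Real.exp (n * x) := by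
    rw [Real.exp_nat_mul]
    exact pow_le_pow_left₀ (by positivity) (by linarith [Real.add_one_le_exp x]) n
  have h0 : 0 ≤ n * x := by positivity
  have h2 := Real.abs_exp_sub_one_le (x := n * x) (by rwa [abs_of_nonneg h0])
  rw [abs_of_nonneg h0] at h2
  linarith [le_abs_self (Real.exp (n * x) - 1)]

theorem tendsto_error_term {Q : ℝ} (hQ : 1 < Q) (D : ℝ) :
    Tendsto (fun n : ℕ => (((n + 1) * D) ^ 2 * Q ^ ((n : ℝ) ^ 2 / 4) *
        ((1 + n * Q ^ (-(n : ℝ) / 32)) ^ n - 1) + n ^ n * Q ^ ((n : ℝ) ^ 2 / 8)) /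
        Q ^ ((n : ℝ) ^ 2 / 4 - n / 64)) atTop (𝓝 0) := by
  have hQ0 : 0 < Q := by linarith
  have lim (j : ℕ) := tendsto_pow_mul_rpow_neg_div hQ (a := 64) (by norm_num) j
  have lim1 : Tendsto (fun n : ℕ => 2 * D ^ 2 * ((n : ℝ) ^ 4 * Q ^ (-(n : ℝ) / 64) +
      2 * ((n : ℝ) ^ 3 * Q ^ (-(n : ℝ) / 64)) + (n : ℝ) ^ 2 * Q ^ (-(n : ℝ) / 64)))
      atTop (𝓝 0) := by
    simpa using (((lim 4).add ((lim 3).const_mul 2)).add (lim 2)).const_mul (2 * D ^ 2)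
  have lim2 : Tendsto (fun n : ℕ => (1 / 2 : ℝ) ^ n) atTop (𝓝 0) :=
    tendsto_pow_atTop_nhds_zero_of_lt_one (by norm_num) (by norm_num)
  have lim3 : ∀ᶠ n : ℕ in atTop, (n : ℝ) ^ 2 * Q ^ (-(n : ℝ) / 32) < 1 :=
    (tendsto_pow_mul_rpow_neg_div hQ (by norm_num) 2).eventually_lt_const one_pos
  have lim4 : ∀ᶠ n : ℕ in atTop,
      Q ^ (1 / 64 : ℝ) * ((n : ℝ) ^ 1 * Q ^ (-(n : ℝ) / 8)) < 1 / 2 := by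
    refine Tendsto.eventually_lt_const (by norm_num : (0 : ℝ) < 1 / 2) ?_
    simpa using (tendsto_pow_mul_rpow_neg_div hQ (a := 8) (by norm_num) 1).const_mul
      (Q ^ (1 / 64 : ℝ))
  have lim12 := lim1.add lim2
  rw [add_zero] at lim12
  refine squeeze_zero' (Eventually.of_forall fun n => ?_) ?_ lim12
  · have : 1 ≤ (1 + n * Q ^ (-(n : ℝ) / 32)) ^ n := one_le_pow₀ (by
      have : 0 ≤ n * Q ^ (-(n : ℝ) / 32) := by positivity
      linarith)
    have h2 := sub_nonneg.2 this
    positivity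
  · filter_upwards [lim3, lim4] with n h3 h4
    rw [add_div]
    refine add_le_add ?_ ?_
    · have h5 := one_add_pow_sub_one_le (x := n * Q ^ (-(n : ℝ) / 32)) (by positivity) n
        (by nlinarith)
      rw [div_le_iff₀ (by positivity)]
      calc _ ≤ ((n + 1) * D) ^ 2 * Q ^ ((n : ℝ) ^ 2 / 4) *
            (2 * (n * (n * Q ^ (-(n : ℝ) / 32)))) := by gcongr
        _ = 2 * D ^ 2 * ((n + 1) ^ 2 * n ^ 2) *
            (Q ^ ((n : ℝ) ^ 2 / 4) * Q ^ (-(n : ℝ) / 32)) := by ring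
        _ = 2 * D ^ 2 * ((n + 1) ^ 2 * n ^ 2) *
            (Q ^ (-(n : ℝ) / 64) * Q ^ ((n : ℝ) ^ 2 / 4 - n / 64)) := by
          rw [← Real.rpow_add hQ0, ← Real.rpow_add hQ0]
          congr 2
          ring
        _ = _ := by ring
    · rw [div_le_iff₀ (by positivity)]
      have h6 : (n : ℝ) ^ n * Q ^ ((n : ℝ) ^ 2 / 8) =
          (Q ^ (1 / 64 : ℝ) * ((n : ℝ) ^ 1 * Q ^ (-(n : ℝ) / 8))) ^ n *
            Q ^ ((n : ℝ) ^ 2 / 4 - n / 64) := by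
        rw [mul_pow, mul_pow, pow_one, ← Real.rpow_mul_natCast hQ0.le,
          ← Real.rpow_mul_natCast hQ0.le, mul_left_comm, mul_assoc, ← Real.rpow_add hQ0,
          ← Real.rpow_add hQ0]
        congr 2
        ring
      rw [h6]
      gcongr

end Asymptotics

theorem StarCond.eventually_le {k : ℕ → ℕ} (h : StarCond 1 (1 / 64) k) :
    ∀ᶠ n : ℕ in atTop, (n : ℝ) ^ 2 / 4 - n / 64 ≤ (k n : ℝ) * ((n : ℝ) - k n) := by
  filter_upwards [h.eventually_le_atBot 0] with n hn
  have := Real.sqrt_nonneg (n : ℝ)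
  linarith

theorem tendsto_atTop_of_mul_sub_ge {a b : ℕ → ℕ} (hb : ∀ n, b n ≤ n)
    (h : ∀ᶠ n : ℕ in atTop, (n : ℝ) ^ 2 / 4 - n / 64 ≤ (a n : ℝ) * b n) :
    Tendsto a atTop atTop := by
  have h1 : Tendsto (fun n : ℕ => (n : ℝ) / 4 - 1 / 64) atTop atTop :=
    tendsto_atTop_add_const_right _ _
      (tendsto_natCast_atTop_atTop.atTop_div_const (by norm_num))
  refine tendsto_natCast_atTop_iff.1 (tendsto_atTop_mono' atTop ?_ h1)
  filter_upwards [h, eventually_gt_atTop 0] with n hn hn0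
  have hn0' : (0 : ℝ) < n := by exact_mod_cast hn0
  have hbn : (b n : ℝ) ≤ n := by exact_mod_cast hb n
  have h2 : (a n : ℝ) * b n ≤ a n * n := by gcongr
  refine le_of_mul_le_mul_right ?_ hn0'
  linarith

theorem stmt9 (q : ℕ) (F : Type) [Field F] [Fintype F] (hq : Fintype.card F = q) :
    ∃ A > (0 : ℝ), ∃ ε > (0 : ℝ), ∀ k : ℕ → ℕ, (∀ n, k n ≤ n) → StarCond A ε k →
      Tendsto (fun n : ℕ => (numClassesDim F (PermGroup F n) (k n) : ℝ) /
          ((q : ℝ) ^ (k n * (n - k n)) / (Kq q * (n.factorial : ℝ))))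
        atTop (𝓝 1) := by
  subst hq
  refine ⟨1, one_pos, 1 / 64, by norm_num, fun k hk hstar => ?_⟩
  have hq := two_le_card (F := F)
  have hQ : (1 : ℝ) < Fintype.card F := by exact_mod_cast hq
  have hQ0 : (0 : ℝ) < Fintype.card F := by linarith
  have hK := Kq_pos hq
  have hT := tendsto_KqTrunc hq
  have hge := hstar.eventually_le
  have hsub (n : ℕ) : ((n - k n : ℕ) : ℝ) = n - k n := Nat.cast_sub (hk n)
  have hk1 : Tendsto k atTop atTop :=
    tendsto_atTop_of_mul_sub_ge (b := fun n => n - k n) (fun n => Nat.sub_le _ _) (by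
      simpa only [hsub] using hge)
  have hk2 : Tendsto (fun n => n - k n) atTop atTop :=
    tendsto_atTop_of_mul_sub_ge hk (by simpa only [hsub, mul_comm] using hge)
  let E (n : ℕ) : ℝ := ∑ σ ∈ (Finset.univ : Finset (Equiv.Perm (Fin n))).erase 1,
      (Nat.card (MulAction.fixedBy
        {V : Submodule F (Fin n → F) // Module.finrank F V = k n} σ) : ℝ)
  have hE : Tendsto (fun n => E n / (Fintype.card F : ℝ) ^ (k n * (n - k n)))
      atTop (𝓝 0) := by
    refine squeeze_zero' (Eventually.of_forall fun n => by positivity) ?_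
      (tendsto_error_term hQ (Kq (Fintype.card F))⁻¹)
    filter_upwards [hge] with n hn
    refine div_le_div₀ ((Finset.sum_nonneg fun σ _ => by positivity).trans
      (sum_card_fixedBy_le n (k n))) (sum_card_fixedBy_le n (k n)) (by positivity) ?_
    rw [← Real.rpow_natCast (Fintype.card F : ℝ)]
    refine Real.rpow_le_rpow_of_exponent_le hQ.le ?_
    rw [Nat.cast_mul, hsub]
    exact hn
  have hmain : Tendsto (fun n => Kq (Fintype.card F) * (KqTrunc (Fintype.card F) n /
      (KqTrunc (Fintype.card F) (n - k n) * KqTrunc (Fintype.card F) (k n))) +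
      Kq (Fintype.card F) * (E n / (Fintype.card F : ℝ) ^ (k n * (n - k n))))
      atTop (𝓝 1) := by
    have h := ((hT.div ((hT.comp hk2).mul (hT.comp hk1)) (by positivity)).const_mul
      (Kq (Fintype.card F))).add (hE.const_mul (Kq (Fintype.card F)))
    have e : Kq (Fintype.card F) * (Kq (Fintype.card F) /
        (Kq (Fintype.card F) * Kq (Fintype.card F))) + Kq (Fintype.card F) * 0 = 1 := by
      field_simp
      simp
    rwa [e] at h
  refine hmain.congr fun n => ?_
  have h1 := congrArg (Nat.cast : ℕ → ℝ) (numClassesDim_mul_factorial F n (k n))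
  rw [Nat.cast_sum, ← Finset.add_sum_erase _ _ (Finset.mem_univ 1), card_fixedBy_one,
    card_grassmannian n (k n) (hk n)] at h1
  change _ = _ + E n at h1
  push_cast at h1
  have hf : (0 : ℝ) < n.factorial := by exact_mod_cast n.factorial_pos
  have hp : (0 : ℝ) < (Fintype.card F : ℝ) ^ (k n * (n - k n)) := by positivity
  rw [div_div_eq_mul_div, eq_div_iff hp.ne']
  have h2 : E n / (Fintype.card F : ℝ) ^ (k n * (n - k n)) *
      (Fintype.card F : ℝ) ^ (k n * (n - k n)) = E n := div_mul_cancel₀ _ hp.ne'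
  linear_combination Kq (Fintype.card F) * h2 - Kq (Fintype.card F) * h1
end
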